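/- There exists a universal constant C (independent of n, V and ρ) such that: if μ(dx) = Z^{-1} e^{-V(x)} dx is a log-concave and isotropic probability measure on ℝ^n, then for all ρ ≥ 0 the measure μ^ρ(dx) = Z_ρ^{-1} e^{-V(x) − (ρ/2)|x|²} dx satisfies C_P(μ^ρ) ≤ C n^{2/3} C_P(μ)^{1/3}. -/

import Mathlib

open MeasureTheory Real Set
open scoped ENNReal RealInnerProductSpace Pointwise Matrix

noncomputable section

/-- Euclidean space ℝ^n. -/
abbrev En (n : ℕ) := EuclideanSpace ℝ (Fin n)

/-- Test functions: smooth, bounded and Lipschitz. -/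
def IsTestFun {n : ℕ} (f : En n → ℝ) : Prop :=
  ContDiff ℝ (⊤ : ℕ∞) f ∧ (∃ M, ∀ x, |f x| ≤ M) ∧ ∃ L, LipschitzWith L f

/-- `μ` satisfies a Poincaré inequality with constant `C`. -/
def PoincareLE {n : ℕ} (μ : Measure (En n)) (C : ℝ) : Prop :=
  ∀ f : En n → ℝ, IsTestFun f →
    (∫ x, (f x) ^ 2 ∂μ) - (∫ x, f x ∂μ) ^ 2 ≤ C * ∫ x, ‖gradient f x‖ ^ 2 ∂μ

/-- `μ` satisfies a logarithmic Sobolev inequality with constant `C`. -/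
def LogSobolevLE {n : ℕ} (μ : Measure (En n)) (C : ℝ) : Prop :=
  ∀ f : En n → ℝ, IsTestFun f →
    (∫ x, (f x) ^ 2 * Real.log ((f x) ^ 2) ∂μ)
        - (∫ x, (f x) ^ 2 ∂μ) * Real.log (∫ x, (f x) ^ 2 ∂μ)
      ≤ C * ∫ x, ‖gradient f x‖ ^ 2 ∂μ

/-- `μ` satisfies an L¹-Poincaré inequality (around the mean) with constant `C`. -/
def CheegerMeanLE {n : ℕ} (μ : Measure (En n)) (C : ℝ) : Prop :=
  ∀ f : En n → ℝ, IsTestFun f →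
    ∫ x, |f x - ∫ y, f y ∂μ| ∂μ ≤ C * ∫ x, ‖gradient f x‖ ∂μ

/-- `m` is a median of `f` under `μ`. -/
def IsMedian {n : ℕ} (μ : Measure (En n)) (f : En n → ℝ) (m : ℝ) : Prop :=
  ENNReal.ofReal (1 / 2) ≤ μ {x | f x ≤ m} ∧ ENNReal.ofReal (1 / 2) ≤ μ {x | m ≤ f x}

/-- `μ` satisfies a Cheeger inequality (around medians) with constant `C`. -/
def CheegerMedianLE {n : ℕ} (μ : Measure (En n)) (C : ℝ) : Prop :=
  ∀ f : En n → ℝ, IsTestFun f → ∀ m : ℝ, IsMedian μ f m →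
    ∫ x, |f x - m| ∂μ ≤ C * ∫ x, ‖gradient f x‖ ∂μ

/-- The perturbed (normalized) measure `μ_F = Z_F⁻¹ e^{-F} μ`. -/
def perturb {n : ℕ} (μ : Measure (En n)) (F : En n → ℝ) : Measure (En n) :=
  (ENNReal.ofReal (∫ x, Real.exp (-F x) ∂μ))⁻¹ •
    μ.withDensity fun x => ENNReal.ofReal (Real.exp (-F x))

/-- Topological support of a measure. -/
def measSupport {n : ℕ} (μ : Measure (En n)) : Set (En n) :=
  {x | ∀ U ∈ nhds x, 0 < μ U}

/-- `μ` is log-concave: it has density `e^{-W}` on a convex set, with `W` convex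
(equivalently, density `e^{-W}` with `W : ℝⁿ → ℝ ∪ {+∞}` convex). -/
def IsLogConcave {n : ℕ} (μ : Measure (En n)) : Prop :=
  ∃ (s : Set (En n)) (W : En n → ℝ), Convex ℝ s ∧ ConvexOn ℝ s W ∧
    μ = volume.withDensity (s.indicator fun x => ENNReal.ofReal (Real.exp (-W x)))

/-- The Laplacian of `F`. -/
def laplacian {n : ℕ} (F : En n → ℝ) (x : En n) : ℝ :=
  ∑ i : Fin n,
    fderiv ℝ (fun y => fderiv ℝ F y (EuclideanSpace.single i (1 : ℝ))) x
      (EuclideanSpace.single i (1 : ℝ))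

/-- The generator `A F = ΔF - ∇V·∇F` associated with `μ = e^{-V} dx`. -/
def genA {n : ℕ} (V F : En n → ℝ) (x : En n) : ℝ :=
  laplacian F x - ⟪gradient V x, gradient F x⟫

/-- The centered Gaussian measure on ℝ^n with covariance matrix `σ² Id`. -/
def gaussMeasure (n : ℕ) (σ : ℝ) : Measure (En n) :=
  volume.withDensity fun x =>
    ENNReal.ofReal ((2 * π * σ ^ 2) ^ (-(n : ℝ) / 2) * Real.exp (-‖x‖ ^ 2 / (2 * σ ^ 2)))

/-- Convolution of two measures. -/
def mconv {n : ℕ} (μ ν : Measure (En n)) : Measure (En n) :=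
  (μ.prod ν).map fun p => p.1 + p.2

/-- Concentration profile of `μ`. -/
def concProfile {n : ℕ} (μ : Measure (En n)) (r : ℝ) : ℝ :=
  sSup {t | ∃ A : Set (En n), MeasurableSet A ∧ (1 : ℝ) / 2 ≤ (μ A).toReal ∧
    t = 1 - (μ (A + Metric.ball (0 : En n) r)).toReal}

/-- Generalized inverse of the concentration profile. -/
def concInv {n : ℕ} (μ : Measure (En n)) (s : ℝ) : ℝ :=
  sInf {r | 0 < r ∧ concProfile μ r ≤ s}

/-- The Hessian matrix of `V` at `x`. -/
def hessMat {n : ℕ} (V : En n → ℝ) (x : En n) : Matrix (Fin n) (Fin n) ℝ :=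
  fun i j =>
    fderiv ℝ (fun y => fderiv ℝ V y (EuclideanSpace.single j (1 : ℝ))) x
      (EuclideanSpace.single i (1 : ℝ))

end

theorem volume_add_le_of_add_subset {A B S : Set ℝ} (hA : MeasurableSet A) (hB : MeasurableSet B)
    (hA0 : A.Nonempty) (hB0 : B.Nonempty) (hS : A + B ⊆ S) :
    volume A + volume B ≤ volume S := by
  have key : ∀ K L : Set ℝ, IsCompact K → IsCompact L → K.Nonempty → L.Nonempty →
      volume K + volume L ≤ volume (K + L) := by
    intro K L hK hL hK0 hL0
    have ha := hK.sSup_mem hK0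
    have hb := hL.sInf_mem hL0
    set a := sSup K
    set b := sInf L
    have h1 : volume ((fun x => x + b) '' K) = volume K := by
      simp
    have h2 : volume ((fun x => a + x) '' L) = volume L := by
      simp
    have hsub : ((fun x => x + b) '' K) ∪ ((fun x => a + x) '' L) ⊆ K + L := by
      rintro _ (⟨x, hx, rfl⟩ | ⟨x, hx, rfl⟩)
      · exact Set.add_mem_add hx hb
      · exact Set.add_mem_add ha hx
    have hdis : AEDisjoint volume ((fun x => x + b) '' K) ((fun x => a + x) '' L) := by
      refine measure_mono_null (t := {a + b}) ?_ (by simp)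
      rintro z ⟨⟨x, hx, rfl⟩, ⟨y, hy, hxy⟩⟩
      have h3 : x ≤ a := le_csSup hK.bddAbove hx
      have h4 : b ≤ y := csInf_le hL.bddBelow hy
      simp only [mem_singleton_iff] at *
      linarith
    rw [← h1, ← h2, ← measure_union₀ ?_ hdis]
    · exact measure_mono hsub
    · exact (hL.image (by fun_prop)).measurableSet.nullMeasurableSet
  obtain ⟨a, ha⟩ := hA0
  obtain ⟨b, hb⟩ := hB0
  rw [hA.measure_eq_iSup_isCompact, hB.measure_eq_iSup_isCompact]
  simp_rw [iSup_and']
  refine ENNReal.biSup_add_biSup_le' ⟨∅, by simp⟩ ⟨∅, by simp⟩ ?_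
  rintro K ⟨hKA, hK⟩ L ⟨hLB, hL⟩
  calc volume K + volume L ≤ volume (insert a K) + volume (insert b L) := by
        gcongr <;> exact subset_insert _ _
    _ ≤ volume (insert a K + insert b L) :=
        key _ _ (hK.insert a) (hL.insert b) (insert_nonempty _ _) (insert_nonempty _ _)
    _ ≤ volume S := measure_mono ((Set.add_subset_add (insert_subset ha hKA)
        (insert_subset hb hLB)).trans hS)

theorem volume_convexComb_le {A B S : Set ℝ} (hA : MeasurableSet A) (hB : MeasurableSet B)
    (hA0 : A.Nonempty) (hB0 : B.Nonempty) {t : ℝ} (ht : t ∈ Ioo (0 : ℝ) 1)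
    (hS : ∀ x ∈ A, ∀ y ∈ B, (1 - t) * x + t * y ∈ S) :
    ENNReal.ofReal (1 - t) * volume A + ENNReal.ofReal t * volume B ≤ volume S := by
  have h1 : volume ((1 - t) • A) = ENNReal.ofReal (1 - t) * volume A := by
    rw [Measure.addHaar_smul]; simp [abs_of_pos (sub_pos.2 ht.2)]
  have h2 : volume (t • B) = ENNReal.ofReal t * volume B := by
    rw [Measure.addHaar_smul]; simp [abs_of_pos ht.1]
  rw [← h1, ← h2]
  refine volume_add_le_of_add_subset (hA.const_smul₀ _) (hB.const_smul₀ _)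
    (hA0.smul_set) (hB0.smul_set) ?_
  rintro _ ⟨_, ⟨x, hx, rfl⟩, _, ⟨y, hy, rfl⟩, rfl⟩
  exact hS x hx y hy

theorem lintegral_eq_lintegral_ofReal_lt {f : ℝ → ℝ≥0∞} (hf : Measurable f)
    (hfin : ∀ x, f x ≠ ∞) :
    ∫⁻ x, f x = ∫⁻ s in Ioi (0 : ℝ), volume {x | ENNReal.ofReal s < f x} := by
  have h := lintegral_eq_lintegral_meas_lt (volume : Measure ℝ) (f := fun x => (f x).toReal)
    (Filter.Eventually.of_forall fun x => ENNReal.toReal_nonneg) hf.ennreal_toReal.aemeasurable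
  rw [lintegral_congr fun x => ENNReal.ofReal_toReal (hfin x)] at h
  rw [h]
  refine setLIntegral_congr_fun measurableSet_Ioi fun s hs => ?_
  congr 1
  ext x
  exact (ENNReal.ofReal_lt_iff_lt_toReal (le_of_lt hs) (hfin x)).symm

/-- The Prékopa–Leindler inequality with parameter `t` for the measure `μ`. -/
def PrekopaLeindler {E : Type*} [AddCommGroup E] [Module ℝ E] [MeasurableSpace E]
    (μ : Measure E) : Prop :=
  ∀ t ∈ Ioo (0 : ℝ) 1, ∀ f g h : E → ℝ≥0∞, Measurable f → Measurable g → Measurable h →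
    (∀ x y, f x ^ (1 - t) * g y ^ t ≤ h ((1 - t) • x + t • y)) →
    (∫⁻ x, f x ∂μ) ^ (1 - t) * (∫⁻ x, g x ∂μ) ^ t ≤ ∫⁻ x, h x ∂μ

theorem prekopaLeindler_real_of_iSup_eq_one {t : ℝ} (ht : t ∈ Ioo (0 : ℝ) 1)
    {f g h : ℝ → ℝ≥0∞} (hf : Measurable f) (hg : Measurable g) (hh : Measurable h)
    (hf1 : ⨆ x, f x = 1) (hg1 : ⨆ x, g x = 1)
    (H : ∀ x y, f x ^ (1 - t) * g y ^ t ≤ h ((1 - t) • x + t • y)) :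
    (∫⁻ x, f x) ^ (1 - t) * (∫⁻ x, g x) ^ t ≤ ∫⁻ x, h x := by
  have ht0 := ht.1
  have ht1 : 0 < 1 - t := sub_pos.2 ht.2
  have hfl : ∀ x, f x ≤ 1 := fun x => hf1 ▸ le_iSup f x
  have hgl : ∀ x, g x ≤ 1 := fun x => hg1 ▸ le_iSup g x
  have hle : (∫⁻ x, f x) ^ (1 - t) * (∫⁻ x, g x) ^ t ≤
      ENNReal.ofReal (1 - t) * (∫⁻ x, f x) + ENNReal.ofReal t * ∫⁻ x, g x := by
    have := ENNReal.young_inequality ((∫⁻ x, f x) ^ (1 - t)) ((∫⁻ x, g x) ^ t)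
      (Real.HolderConjugate.inv_inv ht1 ht0 (by ring))
    rwa [ENNReal.rpow_rpow_inv ht1.ne', ENNReal.rpow_rpow_inv ht0.ne',
      ENNReal.ofReal_inv_of_pos ht1, ENNReal.ofReal_inv_of_pos ht0, div_eq_mul_inv, div_eq_mul_inv,
      inv_inv, inv_inv, mul_comm _ (ENNReal.ofReal (1 - t)), mul_comm _ (ENNReal.ofReal t)] at this
  refine hle.trans ?_
  have h2 : ∫⁻ x, min (h x) 1 ≤ ∫⁻ x, h x := lintegral_mono fun x => min_le_left _ _
  refine le_trans ?_ h2
  rw [lintegral_eq_lintegral_ofReal_lt hf fun x => ne_top_of_le_ne_top ENNReal.one_ne_top (hfl x),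
    lintegral_eq_lintegral_ofReal_lt hg fun x => ne_top_of_le_ne_top ENNReal.one_ne_top (hgl x),
    lintegral_eq_lintegral_ofReal_lt (hh.min measurable_const)
      fun x => ne_top_of_le_ne_top ENNReal.one_ne_top (min_le_right _ _)]
  rw [← lintegral_const_mul' _ _ ENNReal.ofReal_ne_top,
    ← lintegral_const_mul' _ _ ENNReal.ofReal_ne_top, ← lintegral_add_left]
  · refine setLIntegral_mono' measurableSet_Ioi fun s hs => ?_
    have hs0 : (0 : ℝ) < s := hs
    by_cases hs1 : s < 1
    · have hs1' : ENNReal.ofReal s < 1 := by simpa using hs1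
      refine volume_convexComb_le (measurableSet_lt measurable_const hf)
        (measurableSet_lt measurable_const hg) ?_ ?_ ht ?_
      · exact lt_iSup_iff.1 (hf1 ▸ hs1')
      · exact lt_iSup_iff.1 (hg1 ▸ hs1')
      · intro x hx y hy
        simp only [mem_ofPred_eq, lt_min_iff] at *
        refine ⟨lt_of_lt_of_le ?_ (H x y), hs1'⟩
        calc ENNReal.ofReal s = ENNReal.ofReal s ^ (1 - t) * ENNReal.ofReal s ^ t := by
              rw [← ENNReal.rpow_add _ _ (by simpa using hs0) ENNReal.ofReal_ne_top]; simp
          _ < f x ^ (1 - t) * g y ^ t :=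
              ENNReal.mul_lt_mul (ENNReal.rpow_lt_rpow hx ht1) (ENNReal.rpow_lt_rpow hy ht0)
    · have e1 : {x | ENNReal.ofReal s < f x} = ∅ := by
        ext x; simp only [mem_ofPred_eq, mem_empty_iff_false, iff_false, not_lt]
        exact (hfl x).trans (by simpa using hs1)
      have e2 : {x | ENNReal.ofReal s < g x} = ∅ := by
        ext x; simp only [mem_ofPred_eq, mem_empty_iff_false, iff_false, not_lt]
        exact (hgl x).trans (by simpa using hs1)
      simp [e1, e2]
  · refine Measurable.const_mul (Antitone.measurable fun a b hab => measure_mono fun x hx => ?_) _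
    exact lt_of_le_of_lt (ENNReal.ofReal_le_ofReal hab) hx

theorem prekopaLeindler_real : PrekopaLeindler (volume : Measure ℝ) := by
  intro t ht f g h hf hg hh H
  have ht0 := ht.1
  have ht1 : 0 < 1 - t := sub_pos.2 ht.2
  have bdd : ∀ f g : ℝ → ℝ≥0∞, Measurable f → Measurable g → (⨆ x, f x) ≠ ∞ → (⨆ x, g x) ≠ ∞ →
      (∀ x y, f x ^ (1 - t) * g y ^ t ≤ h ((1 - t) • x + t • y)) →
      (∫⁻ x, f x) ^ (1 - t) * (∫⁻ x, g x) ^ t ≤ ∫⁻ x, h x := by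
    intro f g hf hg hfM hgM H
    set M := ⨆ x, f x with hM
    set N := ⨆ x, g x with hN
    by_cases hM0 : M = 0
    · have : ∀ x, f x = 0 := fun x => le_antisymm (hM0 ▸ le_iSup f x) bot_le
      simp [this, ht1]
    by_cases hN0 : N = 0
    · have : ∀ x, g x = 0 := fun x => le_antisymm (hN0 ▸ le_iSup g x) bot_le
      simp [this, ht0]
    have hMi : M⁻¹ ≠ ∞ := ENNReal.inv_ne_top.2 hM0
    have hNi : N⁻¹ ≠ ∞ := ENNReal.inv_ne_top.2 hN0
    set c := M ^ (1 - t) * N ^ t with hc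
    have hc0 : c ≠ 0 := by
      refine mul_ne_zero ?_ ?_ <;> simp [hM0, hN0, hfM, hgM, ENNReal.rpow_eq_zero_iff]
    have hci : c ≠ ∞ := by
      refine ENNReal.mul_ne_top ?_ ?_ <;>
        simp [hM0, hN0, hfM, hgM, ENNReal.rpow_eq_top_iff]
    have hcinv : c⁻¹ = M⁻¹ ^ (1 - t) * N⁻¹ ^ t := by
      rw [hc, ENNReal.mul_inv, ENNReal.inv_rpow, ENNReal.inv_rpow] <;>
        simp [hM0, hN0, hfM, hgM, ENNReal.rpow_eq_top_iff, ENNReal.rpow_eq_zero_iff]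
    have := prekopaLeindler_real_of_iSup_eq_one ht (hf.const_mul M⁻¹) (hg.const_mul N⁻¹)
      (hh.const_mul c⁻¹)
      (by rw [← ENNReal.mul_iSup, ← hM, ENNReal.inv_mul_cancel hM0 hfM])
      (by rw [← ENNReal.mul_iSup, ← hN, ENNReal.inv_mul_cancel hN0 hgM])
      (by
        intro x y
        rw [ENNReal.mul_rpow_of_nonneg _ _ ht1.le, ENNReal.mul_rpow_of_nonneg _ _ ht0.le,
          mul_mul_mul_comm, hcinv]
        gcongr
        exact H x y)
    rw [lintegral_const_mul' _ _ hMi, lintegral_const_mul' _ _ hNi,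
      lintegral_const_mul' _ _ (ENNReal.inv_ne_top.2 hc0),
      ENNReal.mul_rpow_of_nonneg _ _ ht1.le, ENNReal.mul_rpow_of_nonneg _ _ ht0.le,
      mul_mul_mul_comm, ← hcinv] at this
    calc _ = c * (c⁻¹ * ((∫⁻ x, f x) ^ (1 - t) * (∫⁻ x, g x) ^ t)) := by
          rw [← mul_assoc, ENNReal.mul_inv_cancel hc0 hci, one_mul]
      _ ≤ c * (c⁻¹ * ∫⁻ x, h x) := by gcongr
      _ = _ := by rw [← mul_assoc, ENNReal.mul_inv_cancel hc0 hci, one_mul]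
  have lim : ∀ f : ℝ → ℝ≥0∞, Measurable f →
      Filter.Tendsto (fun k : ℕ => ∫⁻ x, min (f x) k) Filter.atTop (nhds (∫⁻ x, f x)) := by
    intro f hf
    refine lintegral_tendsto_of_tendsto_of_monotone
      (fun k => (hf.min measurable_const).aemeasurable) ?_ ?_
    · exact Filter.Eventually.of_forall fun x k l hkl =>
        min_le_min_left _ (by exact_mod_cast hkl)
    · refine Filter.Eventually.of_forall fun x => ?_
      have : Filter.Tendsto (fun k : ℕ => min (f x) (k : ℝ≥0∞)) Filter.atTop
          (nhds (min (f x) ∞)) := tendsto_const_nhds.min ENNReal.tendsto_nat_nhds_top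
      simpa using this
  by_cases hf0 : ∫⁻ x, f x = 0
  · simp [hf0, ht1]
  by_cases hg0 : ∫⁻ x, g x = 0
  · simp [hg0, ht0]
  have hlim := ENNReal.Tendsto.mul
    ((ENNReal.continuous_rpow_const (y := 1 - t)).continuousAt.tendsto.comp (lim f hf))
    (Or.inl (by simp [hf0, ht1, ENNReal.rpow_eq_zero_iff, not_lt.2 ht1.le]))
    ((ENNReal.continuous_rpow_const (y := t)).continuousAt.tendsto.comp (lim g hg))
    (Or.inl (by simp [hg0, ht0, ENNReal.rpow_eq_zero_iff, not_lt.2 ht0.le]))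
  refine le_of_tendsto hlim (Filter.Eventually.of_forall fun k => ?_)
  refine bdd _ _ (hf.min measurable_const) (hg.min measurable_const) ?_ ?_ ?_
  · exact ne_top_of_le_ne_top (ENNReal.natCast_ne_top k) (iSup_le fun x => min_le_right _ _)
  · exact ne_top_of_le_ne_top (ENNReal.natCast_ne_top k) (iSup_le fun x => min_le_right _ _)
  · intro x y
    refine le_trans ?_ (H x y)
    gcongr
    · exact min_le_left _ _
    · exact min_le_left _ _

theorem PrekopaLeindler.prod {E F : Type*} [AddCommGroup E] [Module ℝ E] [MeasurableSpace E]
    [AddCommGroup F] [Module ℝ F] [MeasurableSpace F] {μ : Measure E} {ν : Measure F}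
    [SFinite μ] [SFinite ν] (hμ : PrekopaLeindler μ) (hν : PrekopaLeindler ν) :
    PrekopaLeindler (μ.prod ν) := by
  intro t ht f g h hf hg hh H
  rw [lintegral_prod _ hf.aemeasurable, lintegral_prod _ hg.aemeasurable,
    lintegral_prod _ hh.aemeasurable]
  refine hμ t ht _ _ _ hf.lintegral_prod_right' hg.lintegral_prod_right'
    hh.lintegral_prod_right' fun x y => ?_
  exact hν t ht _ _ _ (hf.comp measurable_prodMk_left) (hg.comp measurable_prodMk_left)
    (hh.comp measurable_prodMk_left) fun x' y' => H (x, x') (y, y')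

theorem PrekopaLeindler.of_measurePreserving {E F : Type*} [AddCommGroup E] [Module ℝ E]
    [MeasurableSpace E] [AddCommGroup F] [Module ℝ F] [MeasurableSpace F] {μ : Measure E}
    {ν : Measure F} (hμ : PrekopaLeindler μ) (e : F ≃ᵐ E) (he : MeasurePreserving e ν μ)
    (hadd : ∀ a b : ℝ, ∀ x y, e (a • x + b • y) = a • e x + b • e y) :
    PrekopaLeindler ν := by
  intro t ht f g h hf hg hh H
  have key : ∀ f : F → ℝ≥0∞, ∫⁻ x, f x ∂ν = ∫⁻ x, f (e.symm x) ∂μ := fun f => by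
    rw [← he.lintegral_comp_emb e.measurableEmbedding]; simp
  rw [key, key, key]
  refine hμ t ht _ _ _ (hf.comp e.symm.measurable) (hg.comp e.symm.measurable)
    (hh.comp e.symm.measurable) fun x y => ?_
  have : e.symm ((1 - t) • x + t • y) = (1 - t) • e.symm x + t • e.symm y := by
    apply e.injective; rw [hadd]; simp
  rw [this]
  exact H _ _

theorem prekopaLeindler_pi (n : ℕ) : PrekopaLeindler (volume : Measure (Fin n → ℝ)) := by
  induction n with
  | zero =>
    intro t ht f g h hf hg hh H
    have hv : (volume : Measure (Fin 0 → ℝ)) = Measure.dirac 0 := by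
      rw [volume_pi, Measure.pi_of_empty _ 0]
    rw [hv, lintegral_dirac, lintegral_dirac, lintegral_dirac]
    simpa using H 0 0
  | succ n ih =>
    refine (prekopaLeindler_real.prod ih).of_measurePreserving
      (MeasurableEquiv.piFinSuccAbove (fun _ => ℝ) 0)
      (volume_preserving_piFinSuccAbove (fun _ => ℝ) 0) fun a b x y => ?_
    ext <;> simp [MeasurableEquiv.piFinSuccAbove, Fin.tail]

theorem prekopaLeindler_euclidean (n : ℕ) : PrekopaLeindler (volume : Measure (En n)) :=
  (prekopaLeindler_pi n).of_measurePreserving (MeasurableEquiv.toLp 2 (Fin n → ℝ)).symm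
    (EuclideanSpace.volume_preserving_symm_measurableEquiv_toLp (Fin n)) fun _ _ _ _ => rfl

theorem ofReal_exp_rpow (a : ℝ) {t : ℝ} (ht : 0 ≤ t) :
    ENNReal.ofReal (Real.exp a) ^ t = ENNReal.ofReal (Real.exp (t * a)) := by
  rw [ENNReal.ofReal_rpow_of_nonneg (Real.exp_pos _).le ht, ← Real.exp_mul, mul_comm]

theorem PrekopaLeindler.withDensity {E : Type*} [AddCommGroup E] [Module ℝ E] [MeasurableSpace E]
    {μ : Measure E} (hμ : PrekopaLeindler μ) {d : E → ℝ≥0∞} (hd : Measurable d)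
    (hdc : ∀ t ∈ Ioo (0 : ℝ) 1, ∀ x y, d x ^ (1 - t) * d y ^ t ≤ d ((1 - t) • x + t • y)) :
    PrekopaLeindler (μ.withDensity d) := by
  intro t ht f g h hf hg hh H
  rw [lintegral_withDensity_eq_lintegral_mul _ hd hf, lintegral_withDensity_eq_lintegral_mul _ hd hg,
    lintegral_withDensity_eq_lintegral_mul _ hd hh]
  refine hμ t ht _ _ _ (hd.mul hf) (hd.mul hg) (hd.mul hh) fun x y => ?_
  simp only [Pi.mul_apply]
  rw [ENNReal.mul_rpow_of_nonneg _ _ (sub_pos.2 ht.2).le, ENNReal.mul_rpow_of_nonneg _ _ ht.1.le,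
    mul_mul_mul_comm]
  exact mul_le_mul' (hdc t ht x y) (H x y)

theorem IsLogConcave.prekopaLeindler {n : ℕ} {μ : Measure (En n)} (hμ : IsLogConcave μ) :
    PrekopaLeindler μ := by
  obtain ⟨s, W, hs, hW, rfl⟩ := hμ
  have hsi : Convex ℝ (interior s) := hs.interior
  have hWi : ConvexOn ℝ (interior s) W := hW.subset interior_subset hsi
  have hae : (s.indicator fun x => ENNReal.ofReal (Real.exp (-W x))) =ᵐ[volume]
      (interior s).indicator fun x => ENNReal.ofReal (Real.exp (-W x)) := by
    refine indicator_ae_eq_of_ae_eq_set ?_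
    have h0 : ∀ᵐ x ∂(volume : Measure (En n)), x ∉ frontier s :=
      measure_eq_zero_iff_ae_notMem.1 (hs.addHaar_frontier volume)
    filter_upwards [h0] with x hx
    refine propext ⟨fun h => ?_, fun h => interior_subset h⟩
    by_contra h'
    exact hx ⟨subset_closure h, h'⟩
  rw [withDensity_congr_ae hae]
  refine (prekopaLeindler_euclidean n).withDensity ?_ ?_
  · classical
    rw [← piecewise_eq_indicator]
    refine ContinuousOn.measurable_piecewise ?_ continuousOn_const isOpen_interior.measurableSet
    exact ENNReal.continuous_ofReal.comp_continuousOn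
      (Real.continuous_exp.comp_continuousOn (hWi.continuousOn isOpen_interior).neg)
  · intro t ht x y
    have ht0 := ht.1
    have ht1 : 0 < 1 - t := sub_pos.2 ht.2
    by_cases hx : x ∈ interior s
    · by_cases hy : y ∈ interior s
      · have hz : (1 - t) • x + t • y ∈ interior s := hsi hx hy ht1.le ht0.le (by ring)
        rw [indicator_of_mem hx, indicator_of_mem hy, indicator_of_mem hz,
          ofReal_exp_rpow _ ht1.le, ofReal_exp_rpow _ ht0.le,
          ← ENNReal.ofReal_mul (Real.exp_pos _).le, ← Real.exp_add]
        refine ENNReal.ofReal_le_ofReal (Real.exp_le_exp.2 ?_)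
        have := hWi.2 hx hy ht1.le ht0.le (by ring)
        simp only [smul_eq_mul] at this
        linarith
      · simp [hy, ht0]
    · simp [hx, ht1]

theorem PrekopaLeindler.measure_le {E : Type*} [AddCommGroup E] [Module ℝ E] [MeasurableSpace E]
    {μ : Measure E} (hμ : PrekopaLeindler μ) {A B S : Set E} (hA : MeasurableSet A)
    (hB : MeasurableSet B) (hS : MeasurableSet S) {t : ℝ} (ht : t ∈ Ioo (0 : ℝ) 1)
    (h : ∀ x ∈ A, ∀ y ∈ B, (1 - t) • x + t • y ∈ S) :
    μ A ^ (1 - t) * μ B ^ t ≤ μ S := by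
  have := hμ t ht (A.indicator 1) (B.indicator 1) (S.indicator 1)
    (measurable_one.indicator hA) (measurable_one.indicator hB) (measurable_one.indicator hS) ?_
  · rwa [lintegral_indicator_one hA, lintegral_indicator_one hB, lintegral_indicator_one hS] at this
  · intro x y
    have ht0 := ht.1
    have ht1 : 0 < 1 - t := sub_pos.2 ht.2
    by_cases hx : x ∈ A
    · by_cases hy : y ∈ B
      · simp [hx, hy, h x hx y hy]
      · simp [hy, ht0]
    · simp [hx, ht1]

theorem PrekopaLeindler.real_le {E : Type*} [AddCommGroup E] [Module ℝ E] [MeasurableSpace E]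
    {μ : Measure E} [IsFiniteMeasure μ] (hμ : PrekopaLeindler μ) {A B S : Set E}
    (hA : MeasurableSet A) (hB : MeasurableSet B) (hS : MeasurableSet S) {t : ℝ}
    (ht : t ∈ Ioo (0 : ℝ) 1) (h : ∀ x ∈ A, ∀ y ∈ B, (1 - t) • x + t • y ∈ S) :
    μ.real A ^ (1 - t) * μ.real B ^ t ≤ μ.real S := by
  have := ENNReal.toReal_mono (measure_ne_top μ S) (hμ.measure_le hA hB hS ht h)
  rwa [ENNReal.toReal_mul, ← ENNReal.toReal_rpow, ← ENNReal.toReal_rpow] at this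

/-- Borell's lemma for balls: a log-concave measure giving mass at least `15/16` to a ball has
exponentially small tails at the scale of its radius. -/
theorem PrekopaLeindler.measureReal_compl_closedBall_le {E : Type*} [NormedAddCommGroup E]
    [NormedSpace ℝ E] [MeasurableSpace E] [BorelSpace E] {μ : Measure E} [IsProbabilityMeasure μ]
    (hμ : PrekopaLeindler μ) {r : ℝ} (hr : μ.real (Metric.closedBall 0 r)ᶜ ≤ 1 / 16) {τ : ℝ}
    (hτ : 1 < τ) : μ.real (Metric.closedBall 0 (τ * r))ᶜ ≤ Real.exp (-τ) := by
  set q := μ.real (Metric.closedBall (0 : E) r)ᶜ with hq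
  set a := μ.real (Metric.closedBall (0 : E) (τ * r))ᶜ with ha
  have hq1 : μ.real (Metric.closedBall (0 : E) r) = 1 - q := by
    rw [hq, probReal_compl_eq_one_sub Metric.isClosed_closedBall.measurableSet]; ring
  have ha0 : 0 ≤ a := measureReal_nonneg
  have hq0 : 0 ≤ q := measureReal_nonneg
  set t : ℝ := (τ - 1) / (τ + 1) with ht
  have hτ1 : 0 < τ + 1 := by linarith
  have ht1 : 1 - t = 2 / (τ + 1) := by rw [ht]; field_simp; ring
  have htI : t ∈ Ioo (0 : ℝ) 1 := by
    refine ⟨div_pos (by linarith) hτ1, ?_⟩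
    have : 0 < 1 - t := by rw [ht1]; positivity
    linarith
  have key := hμ.real_le (A := (Metric.closedBall 0 (τ * r))ᶜ) (B := Metric.closedBall 0 r)
    (S := (Metric.closedBall 0 r)ᶜ) Metric.isClosed_closedBall.measurableSet.compl
    Metric.isClosed_closedBall.measurableSet Metric.isClosed_closedBall.measurableSet.compl
    htI ?_
  · rw [← ha, ← hq, hq1] at key
    have h1 : (15 / 16 : ℝ) ^ t ≤ (1 - q) ^ t :=
      Real.rpow_le_rpow (by norm_num) (by linarith) htI.1.le
    have h2 : a ^ (1 - t) * (15 / 16 : ℝ) ^ t ≤ 1 / 16 :=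
      (mul_le_mul_of_nonneg_left h1 (by positivity)).trans (key.trans hr)
    by_contra hcon
    push Not at hcon
    have h3 : Real.exp (-τ) ^ (1 - t) < a ^ (1 - t) :=
      Real.rpow_lt_rpow (Real.exp_pos _).le hcon (by linarith [htI.2])
    have h4 : Real.exp (-2) ≤ Real.exp (-τ) ^ (1 - t) := by
      rw [← Real.exp_mul, Real.exp_le_exp, ht1, mul_div_assoc', le_div_iff₀ hτ1]
      linarith
    have h5 : (15 / 16 : ℝ) ≤ (15 / 16 : ℝ) ^ t := by
      simpa using Real.rpow_le_rpow_of_exponent_ge (by norm_num : (0 : ℝ) < 15 / 16) (by norm_num)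
        htI.2.le
    have h6 : (1 / 9 : ℝ) ≤ Real.exp (-2) := by
      rw [Real.exp_neg, one_div]
      refine inv_anti₀ (Real.exp_pos _) ?_
      have : Real.exp 2 = Real.exp 1 * Real.exp 1 := by rw [← Real.exp_add]; norm_num
      nlinarith [Real.exp_one_lt_d9, Real.exp_pos 1]
    nlinarith [Real.exp_pos (-2)]
  · intro x hx y hy
    simp only [mem_compl_iff, mem_closedBall_zero_iff, not_le] at *
    have e1 : ‖(1 - t) • x‖ = (1 - t) * ‖x‖ := by
      rw [norm_smul, Real.norm_of_nonneg (by linarith [htI.2])]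
    have e2 : ‖t • y‖ = t * ‖y‖ := by rw [norm_smul, Real.norm_of_nonneg htI.1.le]
    have e3 : ‖(1 - t) • x‖ - ‖t • y‖ ≤ ‖(1 - t) • x + t • y‖ := by
      have := norm_sub_norm_le ((1 - t) • x) (-(t • y))
      rwa [norm_neg, sub_neg_eq_add] at this
    have e4 : (1 - t) * (τ * r) < (1 - t) * ‖x‖ := mul_lt_mul_of_pos_left hx (by linarith [htI.2])
    have e5 : t * ‖y‖ ≤ t * r := mul_le_mul_of_nonneg_left hy htI.1.le
    have e6 : (1 - t) * (τ * r) - t * r = r := by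
      rw [ht1, ht]; field_simp; ring
    linarith

/-- A log-concave measure giving mass at least `15/16` to the ball of radius `r` satisfies
a linear isoperimetric inequality at scale `r` for sets of measure at most one half. -/
theorem PrekopaLeindler.isoperimetry {E : Type*} [NormedAddCommGroup E]
    [NormedSpace ℝ E] [MeasurableSpace E] [BorelSpace E] {μ : Measure E} [IsProbabilityMeasure μ]
    (hμ : PrekopaLeindler μ) {r : ℝ} (hr0 : 0 < r)
    (hr : μ.real (Metric.closedBall 0 r)ᶜ ≤ 1 / 16) {A S : Set E} (hA : MeasurableSet A)
    (hS : MeasurableSet S) (hAS : A ⊆ S) {δ : ℝ} (hδ : 0 < δ) (hδr : δ < r)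
    (hAδ : ∀ x ∈ A, ∀ z, ‖z - x‖ ≤ δ → z ∈ S) (hA2 : μ.real A ≤ 1 / 2) :
    (1 + δ / (16 * r)) * μ.real A ≤ μ.real S := by
  set p := μ.real A with hp
  rcases (measureReal_nonneg : 0 ≤ μ.real A).eq_or_lt with h0 | hp0
  · rw [hp, ← h0, mul_zero]; exact measureReal_nonneg
  rw [← hp] at hp0
  set τ := Real.log (2 / p) with hτ
  have hτ1 : 1 < τ := by
    rw [hτ, Real.lt_log_iff_exp_lt (by positivity)]
    refine Real.exp_one_lt_d9.trans_le ?_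
    rw [le_div_iff₀ hp0]; linarith
  have hexp : Real.exp (-τ) = p / 2 := by
    rw [Real.exp_neg, hτ, Real.exp_log (by positivity), inv_div]
  set B := Metric.closedBall (0 : E) (τ * r) with hB
  have hBm : MeasurableSet B := Metric.isClosed_closedBall.measurableSet
  have hBc : μ.real Bᶜ ≤ p / 2 := hexp ▸ hμ.measureReal_compl_closedBall_le hr hτ1
  have hB1 : 1 - p / 2 ≤ μ.real B := by
    have := probReal_compl_eq_one_sub (μ := μ) hBm
    linarith
  set p' := μ.real (A ∩ B) with hp'
  have hsplit : ∀ T : Set E, μ.real T = μ.real (T ∩ B) + μ.real (T \ B) := fun T =>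
    (measureReal_inter_add_sdiff hBm).symm
  have hp'1 : p / 2 ≤ p' := by
    have h1 := hsplit A
    have h2 : μ.real (A \ B) ≤ μ.real Bᶜ := measureReal_mono (fun x hx => hx.2)
    linarith
  have hp'2 : p' ≤ p := measureReal_mono inter_subset_left
  have hp'0 : 0 < p' := by linarith
  have hτr : 0 < τ * r := by positivity
  set ε := δ / (2 * (τ * r)) with hε
  have hεI : ε ∈ Ioo (0 : ℝ) 1 := by
    refine ⟨by positivity, ?_⟩
    rw [hε, div_lt_one (by positivity)]
    nlinarith
  have key := hμ.real_le (A := A ∩ B) (B := B) (S := S ∩ B) (hA.inter hBm) hBm (hS.inter hBm)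
    hεI ?_
  · have hBp : 0 < μ.real B := by linarith
    have hdiff : μ.real (A \ B) ≤ μ.real (S \ B) :=
      measureReal_mono (fun x hx => ⟨hAS hx.1, hx.2⟩)
    have e1 : p' ^ (1 - ε) * μ.real B ^ ε = p' * Real.exp (ε * Real.log (μ.real B / p')) := by
      rw [Real.rpow_sub hp'0, Real.rpow_one, Real.log_div hBp.ne' hp'0.ne',
        Real.rpow_def_of_pos hp'0, Real.rpow_def_of_pos hBp, mul_sub, Real.exp_sub,
        mul_comm ε, mul_comm ε]
      ring
    have e2 : τ / 4 ≤ Real.log (μ.real B / p') := by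
      have h1 : (3 / 2 : ℝ) ≤ 3 / (4 * p) := by rw [le_div_iff₀ (by positivity)]; linarith
      have h2 : Real.log (3 / (4 * p)) ≤ Real.log (μ.real B / p') := by
        refine Real.log_le_log (by positivity) ?_
        rw [div_le_div_iff₀ (by positivity) hp'0]
        nlinarith
      have h3 : τ ≤ 4 * Real.log (3 / (4 * p)) := by
        have : Real.log ((3 / (4 * p)) ^ 4) = 4 * Real.log (3 / (4 * p)) := by
          rw [Real.log_pow]; norm_num
        rw [← this, hτ]
        refine Real.log_le_log (by positivity) ?_
        have h4 : (2 : ℝ) / p = 8 / 3 * (3 / (4 * p)) := by field_simp; norm_num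
        rw [h4]
        have h5 : (8 / 3 : ℝ) ≤ (3 / (4 * p)) ^ 3 := by
          calc (8 / 3 : ℝ) ≤ (3 / 2) ^ 3 := by norm_num
            _ ≤ _ := by gcongr
        nlinarith
      linarith
    have e3 : 1 + δ / (8 * r) ≤ Real.exp (ε * Real.log (μ.real B / p')) := by
      have h1 : ε * (τ / 4) = δ / (8 * r) := by
        rw [hε]; field_simp; norm_num
      have h2 : ε * (τ / 4) ≤ ε * Real.log (μ.real B / p') :=
        mul_le_mul_of_nonneg_left e2 hεI.1.le
      linarith [Real.add_one_le_exp (ε * Real.log (μ.real B / p'))]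
    have e4 : p' * (1 + δ / (8 * r)) ≤ μ.real (S ∩ B) := by
      refine le_trans ?_ key
      rw [← hp', e1]
      exact mul_le_mul_of_nonneg_left e3 hp'0.le
    have e5 : δ / (16 * r) * p ≤ p' * (δ / (8 * r)) := by
      have : δ / (16 * r) * p = p / 2 * (δ / (8 * r)) := by field_simp; norm_num
      rw [this]
      exact mul_le_mul_of_nonneg_right hp'1 (by positivity)
    have h1 := hsplit A
    have h2 := hsplit S
    linarith
  · intro x hx y hy
    have hxB := hx.2
    rw [hB, mem_closedBall_zero_iff] at hxB hy
    refine ⟨hAδ x hx.1 _ ?_, ?_⟩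
    · have e : (1 - ε) • x + ε • y - x = ε • (y - x) := by module
      rw [e, norm_smul, Real.norm_of_nonneg hεI.1.le]
      have h1 : ‖y - x‖ ≤ 2 * (τ * r) := by
        have := norm_sub_le y x
        linarith
      calc ε * ‖y - x‖ ≤ ε * (2 * (τ * r)) := mul_le_mul_of_nonneg_left h1 hεI.1.le
        _ = δ := by rw [hε]; field_simp
    · exact convex_closedBall (0 : E) (τ * r) (by rwa [mem_closedBall_zero_iff])
        (by rwa [mem_closedBall_zero_iff]) (by linarith [hεI.2]) hεI.1.le (by ring)

theorem norm_gradient_eq {n : ℕ} (f : En n → ℝ) (x : En n) : ‖gradient f x‖ = ‖fderiv ℝ f x‖ := by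
  simp [gradient]

theorem IsTestFun.differentiable {n : ℕ} {f : En n → ℝ} (hf : IsTestFun f) :
    Differentiable ℝ f := hf.1.differentiable (by simp)

theorem IsTestFun.continuous {n : ℕ} {f : En n → ℝ} (hf : IsTestFun f) : Continuous f :=
  hf.1.continuous

theorem IsTestFun.continuous_norm_gradient {n : ℕ} {f : En n → ℝ} (hf : IsTestFun f) :
    Continuous fun x => ‖gradient f x‖ := by
  simp only [norm_gradient_eq]
  exact (hf.1.continuous_fderiv (by simp)).norm

theorem IsTestFun.exists_bound {n : ℕ} {f : En n → ℝ} (hf : IsTestFun f) :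
    ∃ M, 0 < M ∧ ∀ x, |f x| ≤ M := by
  obtain ⟨M, hM⟩ := hf.2.1
  exact ⟨max M 1, by positivity, fun x => (hM x).trans (le_max_left _ _)⟩

theorem IsTestFun.exists_lipschitz {n : ℕ} {f : En n → ℝ} (hf : IsTestFun f) :
    ∃ L : ℝ, 0 < L ∧ (∀ x y, f y - f x ≤ L * ‖y - x‖) ∧ ∀ x, ‖gradient f x‖ ≤ L := by
  obtain ⟨L, hL⟩ := hf.2.2
  refine ⟨L + 1, by positivity, fun x y => ?_, fun x => ?_⟩
  · have h1 := hL.dist_le_mul y x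
    rw [Real.dist_eq, dist_eq_norm] at h1
    have h2 := le_abs_self (f y - f x)
    nlinarith [norm_nonneg (y - x)]
  · rw [norm_gradient_eq]
    have := norm_fderiv_le_of_lipschitz ℝ hL (x₀ := x)
    linarith

theorem IsTestFun.neg {n : ℕ} {f : En n → ℝ} (hf : IsTestFun f) : IsTestFun fun x => -f x := by
  obtain ⟨h1, ⟨M, hM⟩, L, hL⟩ := hf
  exact ⟨h1.neg, ⟨M, fun x => by simpa using hM x⟩, L, hL.neg⟩

theorem norm_gradient_neg {n : ℕ} (f : En n → ℝ) (x : En n) :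
    ‖gradient (fun y => -f y) x‖ = ‖gradient f x‖ := by
  rw [norm_gradient_eq, norm_gradient_eq, fderiv_fun_neg, norm_neg]

theorem eventually_le_add_norm_gradient {n : ℕ} {f : En n → ℝ} {z : En n}
    (hf : DifferentiableAt ℝ f z) {η : ℝ} (hη : 0 < η) :
    ∀ᶠ v in nhds (0 : En n), f (z + v) ≤ f z + ‖v‖ * (‖gradient f z‖ + η) := by
  have h := hasFDerivAt_iff_isLittleO_nhds_zero.1 hf.hasFDerivAt
  filter_upwards [h.def hη] with v hv
  have h1 := le_abs_self (f (z + v) - f z - fderiv ℝ f z v)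
  rw [Real.norm_eq_abs] at hv
  have h2 : fderiv ℝ f z v ≤ ‖gradient f z‖ * ‖v‖ := by
    rw [norm_gradient_eq]
    exact (le_abs_self _).trans ((fderiv ℝ f z).le_opNorm v)
  linarith

theorem integrable_of_bound {E : Type*} [MeasurableSpace E] {μ : Measure E} [IsFiniteMeasure μ]
    {f : E → ℝ} (hf : Measurable f) {M : ℝ} (hM : ∀ x, |f x| ≤ M) : Integrable f μ :=
  Integrable.of_bound hf.aestronglyMeasurable M (Filter.Eventually.of_forall hM)

theorem le_integral_of_eventually_le {E : Type*} [MeasurableSpace E] {μ : Measure E}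
    [IsFiniteMeasure μ] {G : ℕ → E → ℝ} {F : E → ℝ} {M a : ℝ} (hG : ∀ k, Measurable (G k))
    (hF : Measurable F) (hGM : ∀ k x, |G k x| ≤ M) (hFM : ∀ x, |F x| ≤ M)
    (h : ∀ x, ∀ η > 0, ∀ᶠ k in Filter.atTop, G k x ≤ F x + η) (ha : ∀ k, a ≤ ∫ x, G k x ∂μ) :
    a ≤ ∫ x, F x ∂μ := by
  have hmax : ∀ k x, |max (G k x) (F x)| ≤ M := fun k x => by
    rcases max_choice (G k x) (F x) with h | h <;> rw [h]
    · exact hGM k x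
    · exact hFM x
  have hlim : Filter.Tendsto (fun k => ∫ x, max (G k x) (F x) ∂μ) Filter.atTop
      (nhds (∫ x, F x ∂μ)) := by
    refine tendsto_integral_of_dominated_convergence (fun _ => M)
      (fun k => ((hG k).max hF).aestronglyMeasurable) (integrable_const _)
      (fun k => Filter.Eventually.of_forall (hmax k)) (Filter.Eventually.of_forall fun x => ?_)
    rw [Metric.tendsto_nhds]
    intro η hη
    filter_upwards [h x (η / 2) (half_pos hη)] with k hk
    rw [Real.dist_eq, abs_of_nonneg (sub_nonneg.2 (le_max_right _ _))]
    have : max (G k x) (F x) ≤ F x + η / 2 := max_le hk (by linarith)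
    linarith
  refine ge_of_tendsto' hlim fun k => (ha k).trans (integral_mono
    (integrable_of_bound (hG k) (hGM k)) (integrable_of_bound ((hG k).max hF) (hmax k))
    fun x => le_max_left _ _)

/-- The supremum of `g` over the closed ball of radius `δ` around `z`. -/
noncomputable def supBall {n : ℕ} (g : En n → ℝ) (δ : ℝ) (z : En n) : ℝ :=
  ⨆ v : Metric.closedBall (0 : En n) 1, g (z + δ • (v : En n))

theorem bddAbove_range_supBall {n : ℕ} {g : En n → ℝ} {M : ℝ} (hM : ∀ x, g x ≤ M) (δ : ℝ)
    (z : En n) : BddAbove (range fun v : Metric.closedBall (0 : En n) 1 => g (z + δ • (v : En n))) :=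
  ⟨M, by rintro _ ⟨v, rfl⟩; exact hM _⟩

theorem measurable_supBall {n : ℕ} {g : En n → ℝ} (hg : Continuous g) {M : ℝ}
    (hM : ∀ x, g x ≤ M) (δ : ℝ) : Measurable (supBall g δ) :=
  (lowerSemicontinuous_ciSup (fun z => bddAbove_range_supBall hM δ z) fun v =>
    (show Continuous fun z => g (z + δ • (v : En n)) by fun_prop).lowerSemicontinuous).measurable

theorem le_supBall {n : ℕ} {g : En n → ℝ} {M : ℝ} (hM : ∀ x, g x ≤ M) {δ : ℝ} (hδ : 0 < δ)
    {x z : En n} (h : ‖z - x‖ ≤ δ) : g x ≤ supBall g δ z := by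
  have hv : δ⁻¹ • (x - z) ∈ Metric.closedBall (0 : En n) 1 := by
    rw [mem_closedBall_zero_iff, norm_smul, norm_inv, Real.norm_of_nonneg hδ.le, ← norm_sub_rev z x,
      inv_mul_le_iff₀ hδ, mul_one]
    exact h
  have := le_ciSup (bddAbove_range_supBall hM δ z) ⟨_, hv⟩
  simpa [supBall, smul_smul, mul_inv_cancel₀ hδ.ne'] using this

theorem supBall_le {n : ℕ} {g : En n → ℝ} {δ : ℝ} (hδ : 0 ≤ δ) {z : En n} {a : ℝ}
    (h : ∀ v : En n, ‖v‖ ≤ δ → g (z + v) ≤ a) : supBall g δ z ≤ a := by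
  have : Nonempty (Metric.closedBall (0 : En n) 1) := ⟨⟨0, by simp⟩⟩
  refine ciSup_le fun v => h _ ?_
  have := mem_closedBall_zero_iff.1 v.2
  rw [norm_smul, Real.norm_of_nonneg hδ]
  nlinarith

theorem PrekopaLeindler.integral_supBall_ge {n : ℕ} {μ : Measure (En n)} [IsProbabilityMeasure μ]
    (hμ : PrekopaLeindler μ) {r : ℝ} (hr0 : 0 < r)
    (hr : μ.real (Metric.closedBall 0 r)ᶜ ≤ 1 / 16) {g : En n → ℝ} (hg : Continuous g)
    (hg0 : ∀ x, 0 ≤ g x) {M : ℝ} (hM : ∀ x, g x ≤ M) (hg2 : μ.real {x | 0 < g x} ≤ 1 / 2)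
    {δ : ℝ} (hδ : 0 < δ) (hδr : δ < r) :
    (1 + δ / (16 * r)) * ∫ x, g x ∂μ ≤ ∫ x, supBall g δ x ∂μ := by
  have hsm := measurable_supBall hg hM δ
  have hle : ∀ x, g x ≤ supBall g δ x := fun x => le_supBall hM hδ (by simpa using hδ.le)
  have hs0 : ∀ x, 0 ≤ supBall g δ x := fun x => (hg0 x).trans (hle x)
  have hsM : ∀ x, supBall g δ x ≤ M := fun x => supBall_le hδ.le fun v _ => hM _
  have hgi : Integrable g μ := integrable_of_bound hg.measurable (M := M) fun x => by
    rw [abs_of_nonneg (hg0 x)]; exact hM x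
  have hsi : Integrable (supBall g δ) μ := integrable_of_bound hsm (M := M) fun x => by
    rw [abs_of_nonneg (hs0 x)]; exact hsM x
  have hc : 0 ≤ 1 + δ / (16 * r) := by positivity
  rw [← ENNReal.ofReal_le_ofReal_iff (integral_nonneg hs0), ENNReal.ofReal_mul hc,
    ofReal_integral_eq_lintegral_ofReal hgi (Filter.Eventually.of_forall hg0),
    ofReal_integral_eq_lintegral_ofReal hsi (Filter.Eventually.of_forall hs0),
    lintegral_eq_lintegral_meas_lt μ (Filter.Eventually.of_forall hg0) hg.measurable.aemeasurable,
    lintegral_eq_lintegral_meas_lt μ (Filter.Eventually.of_forall hs0) hsm.aemeasurable,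
    ← lintegral_const_mul' _ _ ENNReal.ofReal_ne_top]
  refine setLIntegral_mono' measurableSet_Ioi fun s hs => ?_
  have hs' : (0 : ℝ) < s := hs
  have := hμ.isoperimetry hr0 hr (A := {x | s < g x}) (S := {x | s < supBall g δ x})
    (measurableSet_lt measurable_const hg.measurable) (measurableSet_lt measurable_const hsm)
    (fun x hx => lt_of_lt_of_le hx (hle x)) hδ hδr
    (fun x hx z hz => lt_of_lt_of_le hx (le_supBall hM hδ hz))
    ((measureReal_mono fun x hx => hs'.trans hx).trans hg2)
  rw [← ENNReal.ofReal_le_ofReal_iff measureReal_nonneg, ENNReal.ofReal_mul hc,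
    ofReal_measureReal, ofReal_measureReal] at this
  exact this

theorem PrekopaLeindler.integral_sq_posPart_le {n : ℕ} {μ : Measure (En n)}
    [IsProbabilityMeasure μ] (hμ : PrekopaLeindler μ) {r : ℝ} (hr0 : 0 < r)
    (hr : μ.real (Metric.closedBall 0 r)ᶜ ≤ 1 / 16) {f : En n → ℝ} (hf : IsTestFun f) {m : ℝ}
    (hm : μ.real {x | m < f x} ≤ 1 / 2) :
    ∫ x, max (f x - m) 0 ^ 2 ∂μ ≤ 1024 * r ^ 2 * ∫ x, ‖gradient f x‖ ^ 2 ∂μ := by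
  obtain ⟨M, hM0, hM⟩ := hf.exists_bound
  obtain ⟨L, hL0, hL, hLg⟩ := hf.exists_lipschitz
  have hfc := hf.continuous
  have hgc := hf.continuous_norm_gradient
  set N := M + |m| with hN
  have hN0 : 0 < N := by positivity
  have hpN : ∀ x, max (f x - m) 0 ≤ N := fun x =>
    max_le (by linarith [(abs_le.1 (hM x)).2, neg_abs_le m]) hN0.le
  have hp0 : ∀ x, 0 ≤ max (f x - m) 0 := fun x => le_max_right _ _
  set g : En n → ℝ := fun x => max (f x - m) 0 ^ 2 with hg
  have hgcont : Continuous g := by fun_prop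
  have hgM : ∀ x, g x ≤ N ^ 2 := fun x => pow_le_pow_left₀ (hp0 x) (hpN x) 2
  have hg0 : ∀ x, 0 ≤ g x := fun x => by positivity
  have hinc : ∀ x y e, 0 ≤ e → f y ≤ f x + e → g y ≤ g x + e * (2 * max (f x - m) 0 + e) := by
    intro x y e he hxy
    have h1 : max (f y - m) 0 ≤ max (f x - m) 0 + e :=
      max_le (by linarith [le_max_left (f x - m) 0]) (by linarith [hp0 x])
    have h2 := pow_le_pow_left₀ (hp0 y) h1 2
    simp only [hg]
    linarith
  set δ : ℕ → ℝ := fun k => r * (1 / ((k : ℝ) + 1) / 2) with hδ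
  have hδ0 : ∀ k, 0 < δ k := fun k => by positivity
  have hδr : ∀ k, δ k < r := fun k => by
    have h1 : 1 / ((k : ℝ) + 1) ≤ 1 := by
      rw [div_le_one (by positivity)]; linarith [(Nat.cast_nonneg k : (0 : ℝ) ≤ k)]
    simp only [hδ]; nlinarith
  have hδlim : Filter.Tendsto δ Filter.atTop (nhds 0) := by
    have := (tendsto_one_div_add_atTop_nhds_zero_nat (𝕜 := ℝ)).div_const 2 |>.const_mul r
    simpa [hδ] using this
  have key : (16 * r)⁻¹ * ∫ x, g x ∂μ ≤ ∫ x, 2 * max (f x - m) 0 * ‖gradient f x‖ ∂μ := by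
    refine le_integral_of_eventually_le (G := fun k x => (supBall g (δ k) x - g x) / δ k)
      (M := 2 * N * L + L ^ 2 * r) (fun k => ?_) (by fun_prop) (fun k x => ?_) (fun x => ?_)
      (fun x η hη => ?_) fun k => ?_
    · exact ((measurable_supBall hgcont hgM _).sub hgcont.measurable).div_const _
    · have h1 : g x ≤ supBall g (δ k) x := le_supBall hgM (hδ0 k) (by simpa using (hδ0 k).le)
      have h2 : supBall g (δ k) x ≤ g x + L * δ k * (2 * max (f x - m) 0 + L * δ k) := by
        refine supBall_le (hδ0 k).le fun v hv => hinc x _ _ (mul_pos hL0 (hδ0 k)).le ?_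
        have h3 := hL x (x + v)
        rw [add_sub_cancel_left] at h3
        nlinarith
      rw [abs_of_nonneg (div_nonneg (sub_nonneg.2 h1) (hδ0 k).le), div_le_iff₀ (hδ0 k)]
      have h4 : L * δ k * (2 * max (f x - m) 0 + L * δ k) ≤ L * δ k * (2 * N + L * r) := by
        have := hpN x
        have := (hδr k).le
        have := (mul_pos hL0 (hδ0 k)).le
        gcongr
      nlinarith
    · have h1 := hpN x
      have h2 := hLg x
      rw [abs_of_nonneg (by have := hp0 x; positivity)]
      have : 2 * max (f x - m) 0 * ‖gradient f x‖ ≤ 2 * N * L := by gcongr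
      have : 0 ≤ L ^ 2 * r := by positivity
      linarith
    · set G := ‖gradient f x‖ with hG
      have hG0 : 0 ≤ G := norm_nonneg _
      set P := max (f x - m) 0 with hP
      have hP0 : 0 ≤ P := hp0 x
      have hη' : 0 < η / (2 * (2 * P + 1)) := by positivity
      set η' := η / (2 * (2 * P + 1)) with hη'd
      have hlim2 : Filter.Tendsto (fun k => δ k * (G + η') ^ 2) Filter.atTop (nhds 0) := by
        simpa using hδlim.mul_const ((G + η') ^ 2)
      have hev := Metric.eventually_nhds_iff.1 (eventually_le_add_norm_gradient
        (hf.differentiable x) hη')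
      obtain ⟨ε, hε, hev⟩ := hev
      filter_upwards [hδlim.eventually_lt_const hε, hlim2.eventually_lt_const (half_pos hη)]
        with k hk1 hk2
      rw [div_le_iff₀ (hδ0 k)]
      have h2 : supBall g (δ k) x ≤ g x + δ k * (G + η') * (2 * P + δ k * (G + η')) := by
        refine supBall_le (hδ0 k).le fun v hv => hinc x _ _ (by have := hδ0 k; positivity) ?_
        have h3 := hev (y := v) (by rw [dist_zero_right]; linarith)
        have : ‖v‖ * (G + η') ≤ δ k * (G + η') := by gcongr
        linarith
      have h5 : 2 * P * η' ≤ η / 2 := by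
        rw [hη'd, mul_div_assoc', div_le_iff₀ (by positivity)]
        nlinarith
      have h6 : (G + η') * (2 * P + δ k * (G + η')) ≤ 2 * P * G + η := by nlinarith
      have h7 := mul_le_mul_of_nonneg_left h6 (hδ0 k).le
      nlinarith
    · have h1 := hμ.integral_supBall_ge hr0 hr hgcont hg0 hgM
        ((measureReal_mono fun x (hx : 0 < g x) => by
          by_contra hcon
          have : max (f x - m) 0 = 0 := max_eq_right (by simpa using hcon)
          simp [hg, this] at hx).trans hm) (hδ0 k) (hδr k)
      have hgi : Integrable g μ := integrable_of_bound hgcont.measurable (M := N ^ 2) fun x => by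
        rw [abs_of_nonneg (hg0 x)]; exact hgM x
      have hsi : Integrable (supBall g (δ k)) μ :=
        integrable_of_bound (measurable_supBall hgcont hgM _) (M := N ^ 2) fun x => by
          rw [abs_of_nonneg ((hg0 x).trans (le_supBall hgM (hδ0 k) (by simpa using (hδ0 k).le)))]
          exact supBall_le (hδ0 k).le fun v _ => hgM _
      rw [integral_div, integral_sub hsi hgi, le_div_iff₀ (hδ0 k)]
      have h2 : (16 * r)⁻¹ * (∫ x, g x ∂μ) * δ k = δ k / (16 * r) * ∫ x, g x ∂μ := by
        field_simp
      linarith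
  have hgi : Integrable g μ := integrable_of_bound hgcont.measurable (M := N ^ 2) fun x => by
    rw [abs_of_nonneg (hg0 x)]; exact hgM x
  have hGi : Integrable (fun x => ‖gradient f x‖ ^ 2) μ :=
    integrable_of_bound (hgc.pow 2).measurable (M := L ^ 2) fun x => by
      rw [abs_of_nonneg (by positivity)]
      exact pow_le_pow_left₀ (norm_nonneg _) (hLg x) 2
  have hPi : Integrable (fun x => 2 * max (f x - m) 0 * ‖gradient f x‖) μ :=
    integrable_of_bound (by fun_prop) (M := 2 * N * L) fun x => by
      have h1 := hpN x
      have h2 := hLg x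
      have h3 := hp0 x
      rw [abs_of_nonneg (by positivity)]
      gcongr
  have hyoung : ∫ x, 2 * max (f x - m) 0 * ‖gradient f x‖ ∂μ ≤
      ∫ x, ((32 * r)⁻¹ * g x + 32 * r * ‖gradient f x‖ ^ 2) ∂μ := by
    refine integral_mono hPi ((hgi.const_mul _).add (hGi.const_mul _)) fun x => ?_
    have h1 : 0 ≤ (32 * r)⁻¹ * (max (f x - m) 0 - 32 * r * ‖gradient f x‖) ^ 2 := by positivity
    have h2 : (32 * r)⁻¹ * (max (f x - m) 0 - 32 * r * ‖gradient f x‖) ^ 2 =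
      (32 * r)⁻¹ * g x + 32 * r * ‖gradient f x‖ ^ 2 - 2 * max (f x - m) 0 * ‖gradient f x‖ := by
      simp only [hg]; field_simp; ring
    simp only
    linarith
  rw [integral_add (hgi.const_mul _) (hGi.const_mul _), integral_const_mul,
    integral_const_mul] at hyoung
  have h3 := key.trans hyoung
  have h4 : (16 * r)⁻¹ = 2 * (32 * r)⁻¹ := by field_simp; norm_num
  rw [h4] at h3
  have h5 : (32 * r)⁻¹ * ∫ x, g x ∂μ ≤ 32 * r * ∫ x, ‖gradient f x‖ ^ 2 ∂μ := by linarith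
  rw [inv_mul_le_iff₀ (by positivity)] at h5
  calc ∫ x, g x ∂μ ≤ _ := h5
    _ = _ := by ring

theorem exists_median {E : Type*} [MeasurableSpace E] {μ : Measure E} [IsProbabilityMeasure μ]
    {f : E → ℝ} (hf : Measurable f) {M : ℝ} (hM : ∀ x, |f x| ≤ M) :
    ∃ m, μ.real {x | m < f x} ≤ 1 / 2 ∧ μ.real {x | f x < m} ≤ 1 / 2 := by
  set S : Set ℝ := {t | μ.real {x | t < f x} ≤ 1 / 2} with hS
  have hMS : M ∈ S := by
    have : {x | M < f x} = ∅ := by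
      ext x; simpa using (abs_le.1 (hM x)).2
    simp [hS, this]
  have hbdd : BddBelow S := by
    refine ⟨-M, fun t ht => ?_⟩
    by_contra hcon
    have : {x | t < f x} = univ := by
      ext x; simpa using (not_le.1 hcon).trans_le (abs_le.1 (hM x)).1
    simp only [hS, mem_ofPred_eq, this, probReal_univ] at ht
    norm_num at ht
  have hup : ∀ s t, s ∈ S → s ≤ t → t ∈ S := fun s t hs hst =>
    (measureReal_mono fun x (hx : t < f x) => lt_of_le_of_lt hst hx).trans hs
  have hanti : Antitone fun k : ℕ => 1 / ((k : ℝ) + 1) := fun k l hkl =>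
    one_div_le_one_div_of_le (by positivity) (by gcongr)
  refine ⟨sInf S, ?_, ?_⟩
  · have hU : {x | sInf S < f x} = ⋃ k : ℕ, {x | sInf S + 1 / ((k : ℝ) + 1) < f x} := by
      ext x
      simp only [mem_ofPred_eq, mem_iUnion]
      refine ⟨fun h => ?_, fun ⟨k, hk⟩ => lt_trans (lt_add_of_pos_right _ (by positivity)) hk⟩
      obtain ⟨k, hk⟩ := exists_nat_one_div_lt (sub_pos.2 h)
      exact ⟨k, by linarith⟩
    have hlim := tendsto_measure_iUnion_atTop (μ := μ)
      (s := fun k : ℕ => {x | sInf S + 1 / ((k : ℝ) + 1) < f x})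
      fun k l hkl x (hx : _ < f x) => lt_of_le_of_lt (add_le_add_right (hanti hkl) _) hx
    rw [← hU] at hlim
    have hlim' := (ENNReal.tendsto_toReal (measure_ne_top μ _)).comp hlim
    refine le_of_tendsto' hlim' fun k => ?_
    obtain ⟨s, hs, hsk⟩ := exists_lt_of_csInf_lt ⟨M, hMS⟩
      (lt_add_of_pos_right (sInf S) (by positivity : 0 < 1 / ((k : ℝ) + 1)))
    exact hup s _ hs hsk.le
  · have hU : {x | f x < sInf S} = ⋃ k : ℕ, {x | f x ≤ sInf S - 1 / ((k : ℝ) + 1)} := by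
      ext x
      simp only [mem_ofPred_eq, mem_iUnion]
      refine ⟨fun h => ?_, fun ⟨k, hk⟩ => lt_of_le_of_lt hk (sub_lt_self _ (by positivity))⟩
      obtain ⟨k, hk⟩ := exists_nat_one_div_lt (sub_pos.2 h)
      exact ⟨k, by linarith⟩
    have hlim := tendsto_measure_iUnion_atTop (μ := μ)
      (s := fun k : ℕ => {x | f x ≤ sInf S - 1 / ((k : ℝ) + 1)})
      fun k l hkl x (hx : f x ≤ _) => hx.trans (sub_le_sub_left (hanti hkl) _)
    rw [← hU] at hlim
    have hlim' := (ENNReal.tendsto_toReal (measure_ne_top μ _)).comp hlim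
    refine le_of_tendsto' hlim' fun k => ?_
    have hnot : sInf S - 1 / ((k : ℝ) + 1) ∉ S := fun h => by
      have h1 := csInf_le hbdd h
      have h2 : 0 < 1 / ((k : ℝ) + 1) := by positivity
      linarith
    have hcompl : {x | f x ≤ sInf S - 1 / ((k : ℝ) + 1)} =
        {x | sInf S - 1 / ((k : ℝ) + 1) < f x}ᶜ := by ext x; simp
    have h3 := probReal_compl_eq_one_sub (μ := μ)
      (measurableSet_lt (measurable_const (a := sInf S - 1 / ((k : ℝ) + 1))) hf)
    have hlt : 1 / 2 < μ.real {x | sInf S - 1 / ((k : ℝ) + 1) < f x} := not_le.1 hnot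
    change μ.real {x | f x ≤ sInf S - 1 / ((k : ℝ) + 1)} ≤ 1 / 2
    rw [hcompl]
    linarith

theorem variance_le_integral_sub_sq {E : Type*} [MeasurableSpace E] {μ : Measure E}
    [IsProbabilityMeasure μ] {f : E → ℝ} (hf : Integrable f μ)
    (hf2 : Integrable (fun x => f x ^ 2) μ) (a : ℝ) :
    (∫ x, f x ^ 2 ∂μ) - (∫ x, f x ∂μ) ^ 2 ≤ ∫ x, (f x - a) ^ 2 ∂μ := by
  have h : ∫ x, (f x - a) ^ 2 ∂μ = (∫ x, f x ^ 2 ∂μ) - 2 * a * (∫ x, f x ∂μ) + a ^ 2 := by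
    have : ∀ x, (f x - a) ^ 2 = f x ^ 2 - 2 * a * f x + a ^ 2 := fun x => by ring
    simp only [this]
    have hi : Integrable (fun x => f x ^ 2 - 2 * a * f x) μ := hf2.sub (hf.const_mul _)
    rw [integral_add hi (integrable_const _),
      integral_sub hf2 (hf.const_mul _), integral_const_mul]
    simp
  rw [h]
  nlinarith [sq_nonneg ((∫ x, f x ∂μ) - a)]

theorem IsTestFun.integrable {n : ℕ} {f : En n → ℝ} (hf : IsTestFun f) (μ : Measure (En n))
    [IsFiniteMeasure μ] : Integrable f μ := by
  obtain ⟨M, -, hM⟩ := hf.exists_bound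
  exact integrable_of_bound hf.continuous.measurable hM

theorem IsTestFun.integrable_sub_sq {n : ℕ} {f : En n → ℝ} (hf : IsTestFun f)
    (μ : Measure (En n)) [IsFiniteMeasure μ] (a : ℝ) : Integrable (fun x => (f x - a) ^ 2) μ := by
  obtain ⟨M, hM0, hM⟩ := hf.exists_bound
  have := hf.continuous
  refine integrable_of_bound (by fun_prop) (M := (M + |a|) ^ 2) fun x => ?_
  rw [abs_pow]
  gcongr
  exact (abs_sub _ _).trans (by gcongr; exact hM x)

theorem IsTestFun.integrable_sq {n : ℕ} {f : En n → ℝ} (hf : IsTestFun f)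
    (μ : Measure (En n)) [IsFiniteMeasure μ] : Integrable (fun x => f x ^ 2) μ := by
  simpa using hf.integrable_sub_sq μ 0

theorem IsTestFun.integrable_norm_gradient_sq {n : ℕ} {f : En n → ℝ} (hf : IsTestFun f)
    (μ : Measure (En n)) [IsFiniteMeasure μ] : Integrable (fun x => ‖gradient f x‖ ^ 2) μ := by
  obtain ⟨L, hL0, -, hL⟩ := hf.exists_lipschitz
  have := hf.continuous_norm_gradient
  refine integrable_of_bound (this.pow 2).measurable (M := L ^ 2) fun x => ?_
  rw [abs_of_nonneg (by positivity)]
  exact pow_le_pow_left₀ (norm_nonneg _) (hL x) 2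

theorem PrekopaLeindler.poincareLE {n : ℕ} {μ : Measure (En n)} [IsProbabilityMeasure μ]
    (hμ : PrekopaLeindler μ) {r : ℝ} (hr0 : 0 < r)
    (hr : μ.real (Metric.closedBall 0 r)ᶜ ≤ 1 / 16) : PoincareLE μ (2048 * r ^ 2) := by
  intro f hf
  obtain ⟨M, -, hM⟩ := hf.exists_bound
  have hfc := hf.continuous
  obtain ⟨m, hm1, hm2⟩ := exists_median (μ := μ) hf.continuous.measurable hM
  have h1 := hμ.integral_sq_posPart_le hr0 hr hf hm1
  have h2 := hμ.integral_sq_posPart_le hr0 hr hf.neg (m := -m) (by simpa using hm2)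
  simp only [norm_gradient_neg] at h2
  refine (variance_le_integral_sub_sq (hf.integrable μ) (hf.integrable_sq μ) m).trans ?_
  have hi := hf.integrable_sub_sq μ m
  have hb : ∀ a : ℝ, max a 0 ^ 2 ≤ a ^ 2 := fun a => by
    rcases le_total a 0 with h | h <;> simp [h, sq_nonneg]
  have hi1 : Integrable (fun x => max (f x - m) 0 ^ 2) μ :=
    hi.mono' (by fun_prop) (Filter.Eventually.of_forall fun x => by
      rw [Real.norm_of_nonneg (by positivity)]; exact hb _)
  have hi2 : Integrable (fun x => max (-f x - -m) 0 ^ 2) μ :=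
    hi.mono' (by fun_prop) (Filter.Eventually.of_forall fun x => by
      rw [Real.norm_of_nonneg (by positivity)]
      refine (hb _).trans (le_of_eq (by ring)))
  have h3 : ∫ x, (f x - m) ^ 2 ∂μ = (∫ x, max (f x - m) 0 ^ 2 ∂μ) +
      ∫ x, max (-f x - -m) 0 ^ 2 ∂μ := by
    rw [← integral_add hi1 hi2]
    congr 1
    ext x
    rcases le_total (f x - m) 0 with h | h
    · rw [max_eq_right h, max_eq_left (by linarith)]; ring
    · rw [max_eq_left h, max_eq_right (by linarith)]; ring
  rw [h3]
  linarith

theorem integrable_norm_sq_of_isotropic {n : ℕ} {μ : Measure (En n)}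
    (h : ∀ i : Fin n, ∫ x, x i * x i ∂μ = 1) : Integrable (fun x => ‖x‖ ^ 2) μ := by
  simp only [EuclideanSpace.real_norm_sq_eq]
  simp only [pow_two]
  refine integrable_finsetSum _ fun i _ => ?_
  by_contra hcon
  have := h i
  rw [integral_undef hcon] at this
  exact zero_ne_one this

theorem integral_norm_sq_of_isotropic {n : ℕ} {μ : Measure (En n)}
    (h : ∀ i : Fin n, ∫ x, x i * x i ∂μ = 1) : ∫ x, ‖x‖ ^ 2 ∂μ = n := by
  simp only [EuclideanSpace.real_norm_sq_eq]
  simp only [pow_two]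
  rw [integral_finsetSum]
  · simp [h]
  · intro i _
    by_contra hcon
    have := h i
    rw [integral_undef hcon] at this
    exact zero_ne_one this

theorem PrekopaLeindler.poincareLE_of_isotropic {n : ℕ} (hn : 0 < n) {μ : Measure (En n)}
    [IsProbabilityMeasure μ] (hμ : PrekopaLeindler μ)
    (h : ∀ i : Fin n, ∫ x, x i * x i ∂μ = 1) : PoincareLE μ (32768 * n) := by
  have hn' : (0 : ℝ) < n := by exact_mod_cast hn
  have h1 := mul_meas_ge_le_integral_of_nonneg (μ := μ) (f := fun x => ‖x‖ ^ 2)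
    (Filter.Eventually.of_forall fun x => by positivity) (integrable_norm_sq_of_isotropic h)
    (16 * n)
  rw [integral_norm_sq_of_isotropic h] at h1
  have hsq : (4 * √(n : ℝ)) ^ 2 = 16 * n := by
    rw [mul_pow, Real.sq_sqrt hn'.le]; norm_num
  have h2 := hμ.poincareLE (r := 4 * √(n : ℝ)) (by positivity) ?_
  · rw [hsq] at h2
    convert h2 using 1
    ring
  · have h3 : μ.real (Metric.closedBall 0 (4 * √(n : ℝ)))ᶜ ≤ μ.real {x | 16 * (n : ℝ) ≤ ‖x‖ ^ 2} := by
      refine measureReal_mono fun x hx => ?_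
      simp only [mem_compl_iff, mem_closedBall_zero_iff, not_le] at hx
      have := pow_le_pow_left₀ (by positivity) hx.le 2
      rwa [hsq] at this
    refine h3.trans ?_
    by_contra hcon
    push Not at hcon
    nlinarith

/-- A Gaussian-improved Prékopa–Leindler inequality. -/
def GaussianPrekopaLeindler {n : ℕ} (ρ : ℝ) (μ : Measure (En n)) : Prop :=
  ∀ t ∈ Ioo (0 : ℝ) 1, ∀ f g h : En n → ℝ≥0∞, Measurable f → Measurable g → Measurable h →
    (∀ x y, f x ^ (1 - t) * g y ^ t *
      ENNReal.ofReal (Real.exp (-(ρ / 2 * (t * (1 - t)) * ‖x - y‖ ^ 2))) ≤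
        h ((1 - t) • x + t • y)) →
    (∫⁻ x, f x ∂μ) ^ (1 - t) * (∫⁻ x, g x ∂μ) ^ t ≤ ∫⁻ x, h x ∂μ

theorem norm_sq_convexComb {n : ℕ} (t : ℝ) (x y : En n) :
    ‖(1 - t) • x + t • y‖ ^ 2 =
      (1 - t) * ‖x‖ ^ 2 + t * ‖y‖ ^ 2 - t * (1 - t) * ‖x - y‖ ^ 2 := by
  rw [norm_add_sq_real, norm_sub_sq_real, norm_smul, norm_smul, real_inner_smul_left,
    real_inner_smul_right, mul_pow, mul_pow, Real.norm_eq_abs, Real.norm_eq_abs, sq_abs, sq_abs]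
  ring

theorem PrekopaLeindler.perturb {n : ℕ} {μ : Measure (En n)} (hμ : PrekopaLeindler μ) (ρ : ℝ) :
    GaussianPrekopaLeindler ρ (perturb μ fun x => ρ / 2 * ‖x‖ ^ 2) := by
  intro t ht f g h hf hg hh H
  have ht0 := ht.1.le
  have ht1 : 0 ≤ 1 - t := sub_nonneg.2 ht.2.le
  have hd : Measurable fun x : En n => ENNReal.ofReal (Real.exp (-(ρ / 2 * ‖x‖ ^ 2))) := by fun_prop
  simp only [_root_.perturb, lintegral_smul_measure, smul_eq_mul]
  rw [lintegral_withDensity_eq_lintegral_mul _ hd hf, lintegral_withDensity_eq_lintegral_mul _ hd hg,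
    lintegral_withDensity_eq_lintegral_mul _ hd hh]
  have key := hμ t ht _ _ _ (hd.mul hf) (hd.mul hg) (hd.mul hh) fun x y => by
    simp only [Pi.mul_apply]
    rw [ENNReal.mul_rpow_of_nonneg _ _ ht1, ENNReal.mul_rpow_of_nonneg _ _ ht0,
      ofReal_exp_rpow _ ht1, ofReal_exp_rpow _ ht0]
    refine le_trans (le_of_eq ?_) (mul_le_mul' le_rfl (H x y))
    have e : ENNReal.ofReal (Real.exp (-(ρ / 2 * ‖(1 - t) • x + t • y‖ ^ 2))) *
        ENNReal.ofReal (Real.exp (-(ρ / 2 * (t * (1 - t)) * ‖x - y‖ ^ 2))) =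
        ENNReal.ofReal (Real.exp ((1 - t) * -(ρ / 2 * ‖x‖ ^ 2))) *
        ENNReal.ofReal (Real.exp (t * -(ρ / 2 * ‖y‖ ^ 2))) := by
      rw [← ENNReal.ofReal_mul (Real.exp_pos _).le, ← ENNReal.ofReal_mul (Real.exp_pos _).le,
        ← Real.exp_add, ← Real.exp_add, norm_sq_convexComb]
      congr 2
      ring
    rw [mul_mul_mul_comm, ← e]
    ring
  set c := (ENNReal.ofReal (∫ x, Real.exp (-(ρ / 2 * ‖x‖ ^ 2)) ∂μ))⁻¹
  rw [ENNReal.mul_rpow_of_nonneg _ _ ht1, ENNReal.mul_rpow_of_nonneg _ _ ht0, mul_mul_mul_comm,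
    ← ENNReal.rpow_add_of_nonneg _ _ ht1 ht0, sub_add_cancel, ENNReal.rpow_one]
  exact mul_le_mul' le_rfl key

theorem perturb_eq_tilted {n : ℕ} (μ : Measure (En n)) [IsProbabilityMeasure μ]
    {F : En n → ℝ} (hF : Integrable (fun x => Real.exp (-F x)) μ) :
    perturb μ F = μ.tilted fun x => -F x := by
  have hZ : 0 < ∫ x, Real.exp (-F x) ∂μ := integral_exp_pos hF
  rw [perturb, Measure.tilted, ← withDensity_smul' _ _ (by simpa using hZ)]
  congr 1
  ext x
  rw [Pi.smul_apply, smul_eq_mul, ENNReal.ofReal_div_of_pos hZ, mul_comm, ENNReal.div_eq_inv_mul,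
    mul_comm]

theorem integrable_exp_neg_norm_sq {n : ℕ} (μ : Measure (En n)) [IsFiniteMeasure μ] {c : ℝ}
    (hc : 0 ≤ c) : Integrable (fun x => Real.exp (-(c * ‖x‖ ^ 2))) μ :=
  integrable_of_bound (by fun_prop) (M := 1) fun x => by
    rw [abs_of_pos (Real.exp_pos _), Real.exp_le_one_iff]
    have : 0 ≤ c * ‖x‖ ^ 2 := by positivity
    linarith

theorem isProbabilityMeasure_perturb {n : ℕ} (μ : Measure (En n)) [IsProbabilityMeasure μ]
    {F : En n → ℝ} (hF : Integrable (fun x => Real.exp (-F x)) μ) :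
    IsProbabilityMeasure (perturb μ F) := by
  rw [perturb_eq_tilted μ hF]
  exact isProbabilityMeasure_tilted hF

theorem integral_perturb {n : ℕ} (μ : Measure (En n)) [IsProbabilityMeasure μ]
    {F : En n → ℝ} (hF : Integrable (fun x => Real.exp (-F x)) μ) (f : En n → ℝ) :
    ∫ x, f x ∂(perturb μ F) = (∫ x, Real.exp (-F x) ∂μ)⁻¹ * ∫ x, Real.exp (-F x) * f x ∂μ := by
  rw [perturb_eq_tilted μ hF, integral_tilted, ← integral_const_mul]
  congr 1
  ext x
  rw [smul_eq_mul]
  ring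

theorem integrable_perturb_iff {n : ℕ} (μ : Measure (En n)) [IsProbabilityMeasure μ]
    {F : En n → ℝ} (hF : Integrable (fun x => Real.exp (-F x)) μ) (f : En n → ℝ) :
    Integrable f (perturb μ F) ↔ Integrable (fun x => Real.exp (-F x) * f x) μ := by
  rw [perturb_eq_tilted μ hF, integrable_tilted_iff hF]
  simp only [smul_eq_mul]

/-- The Hopf–Lax type supremal convolution of `g` at time `s`. -/
noncomputable def supConv {n : ℕ} (g : En n → ℝ) (s : ℝ) (z : En n) : ℝ :=
  ⨆ v : En n, (g (z + v) - ‖v‖ ^ 2 / (2 * s))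

theorem bddAbove_range_supConv {n : ℕ} {g : En n → ℝ} {M : ℝ} (hM : ∀ x, g x ≤ M) {s : ℝ}
    (hs : 0 ≤ s) (z : En n) : BddAbove (range fun v : En n => g (z + v) - ‖v‖ ^ 2 / (2 * s)) := by
  refine ⟨M, ?_⟩
  rintro _ ⟨v, rfl⟩
  have : 0 ≤ ‖v‖ ^ 2 / (2 * s) := by positivity
  linarith [hM (z + v)]

theorem measurable_supConv {n : ℕ} {g : En n → ℝ} (hg : Continuous g) {M : ℝ}
    (hM : ∀ x, g x ≤ M) {s : ℝ} (hs : 0 ≤ s) : Measurable (supConv g s) :=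
  (lowerSemicontinuous_ciSup (fun z => bddAbove_range_supConv hM hs z) fun v =>
    (show Continuous fun z => g (z + v) - ‖v‖ ^ 2 / (2 * s) by
      fun_prop).lowerSemicontinuous).measurable

theorem le_supConv {n : ℕ} {g : En n → ℝ} {M : ℝ} (hM : ∀ x, g x ≤ M) {s : ℝ} (hs : 0 ≤ s)
    (z v : En n) : g (z + v) - ‖v‖ ^ 2 / (2 * s) ≤ supConv g s z :=
  le_ciSup (bddAbove_range_supConv hM hs z) v

theorem mul_sub_sq_div_le {s : ℝ} (hs : 0 < s) (a b : ℝ) : a * b - a ^ 2 / (2 * s) ≤ s * b ^ 2 / 2 := by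
  have : 0 ≤ (a - s * b) ^ 2 / (2 * s) := by positivity
  have e : (a - s * b) ^ 2 / (2 * s) = a ^ 2 / (2 * s) - a * b + s * b ^ 2 / 2 := by
    field_simp; ring
  linarith

theorem supConv_le_add_lipschitz {n : ℕ} {g : En n → ℝ} {L : ℝ}
    (hL : ∀ x y, g y - g x ≤ L * ‖y - x‖) {s : ℝ} (hs : 0 < s) (z : En n) :
    supConv g s z ≤ g z + s * L ^ 2 / 2 := by
  refine ciSup_le fun v => ?_
  have h1 := hL z (z + v)
  rw [add_sub_cancel_left] at h1
  have h2 := mul_sub_sq_div_le hs ‖v‖ L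
  linarith

theorem supConv_le_add_of_local {n : ℕ} {g : En n → ℝ} {L : ℝ}
    (hL : ∀ x y, g y - g x ≤ L * ‖y - x‖) {s : ℝ} (hs : 0 < s) {z : En n} {δ b : ℝ}
    (hb : ∀ v : En n, ‖v‖ < δ → g (z + v) ≤ g z + ‖v‖ * b) (hδ : 2 * L * s < δ) :
    supConv g s z ≤ g z + s * b ^ 2 / 2 := by
  refine ciSup_le fun v => ?_
  rcases lt_or_ge ‖v‖ δ with hv | hv
  · have h2 := mul_sub_sq_div_le hs ‖v‖ b
    linarith [hb v hv]
  · have h1 := hL z (z + v)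
    rw [add_sub_cancel_left] at h1
    have h3 : L * ‖v‖ ≤ ‖v‖ ^ 2 / (2 * s) := by
      rw [le_div_iff₀ (by positivity)]
      nlinarith [norm_nonneg v]
    have h4 : 0 ≤ s * b ^ 2 / 2 := by positivity
    linarith

theorem abs_exp_sub_exp_le {a b M : ℝ} (ha : a ≤ M) (hb : b ≤ M) :
    |Real.exp a - Real.exp b| ≤ Real.exp M * |a - b| := by
  have key : ∀ a b : ℝ, a ≤ M → b ≤ a → Real.exp a - Real.exp b ≤ Real.exp M * (a - b) := by
    intro a b ha hba
    have h1 : Real.exp b = Real.exp a * Real.exp (b - a) := by rw [← Real.exp_add]; ring_nf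
    have h2 := Real.add_one_le_exp (b - a)
    have h3 := Real.exp_le_exp.2 ha
    have h4 : Real.exp a * (a - b) ≤ Real.exp M * (a - b) :=
      mul_le_mul_of_nonneg_right h3 (by linarith)
    have h5 := mul_le_mul_of_nonneg_left h2 (Real.exp_pos a).le
    rw [h1]
    linarith
  rcases le_total a b with h | h
  · rw [abs_sub_comm, abs_sub_comm a b, abs_of_nonneg (sub_nonneg.2 (Real.exp_le_exp.2 h)),
      abs_of_nonneg (sub_nonneg.2 h)]
    exact key b a hb h
  · rw [abs_of_nonneg (sub_nonneg.2 (Real.exp_le_exp.2 h)), abs_of_nonneg (sub_nonneg.2 h)]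
    exact key a b ha h

theorem GaussianPrekopaLeindler.rpow_integral_exp_le {n : ℕ} {ν : Measure (En n)}
    [IsProbabilityMeasure ν] {ρ : ℝ} (hρ : 0 < ρ) (hν : GaussianPrekopaLeindler ρ ν)
    {g : En n → ℝ} (hg : Continuous g) {M : ℝ} (hM : ∀ x, |g x| ≤ M) {ε : ℝ}
    (hε : ε ∈ Ioo (0 : ℝ) 1) :
    (∫ x, Real.exp (g x) ∂ν) ^ (1 - ε) ≤ ∫ x, Real.exp ((1 - ε) * supConv g (ε / ρ) x) ∂ν := by
  have hε0 := hε.1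
  have hε1 : 0 < 1 - ε := sub_pos.2 hε.2
  have hs : 0 < ε / ρ := by positivity
  have hM' : ∀ x, g x ≤ M := fun x => (le_abs_self _).trans (hM x)
  have hQm := measurable_supConv hg hM' hs.le
  have hQM : ∀ x, supConv g (ε / ρ) x ≤ M := fun x => ciSup_le fun v => by
    have : 0 ≤ ‖v‖ ^ 2 / (2 * (ε / ρ)) := by positivity
    linarith [hM' (x + v)]
  have key := hν ε hε (fun x => ENNReal.ofReal (Real.exp (g x))) (fun _ => 1)
    (fun x => ENNReal.ofReal (Real.exp ((1 - ε) * supConv g (ε / ρ) x)))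
    (by have := hg.measurable; fun_prop) measurable_const (by fun_prop) fun x y => by
      rw [ofReal_exp_rpow _ hε1.le, ENNReal.one_rpow, mul_one,
        ← ENNReal.ofReal_mul (Real.exp_pos _).le, ← Real.exp_add]
      refine ENNReal.ofReal_le_ofReal (Real.exp_le_exp.2 ?_)
      have h1 := le_supConv hM' hs.le ((1 - ε) • x + ε • y) (ε • (x - y))
      have e1 : (1 - ε) • x + ε • y + ε • (x - y) = x := by module
      rw [e1, norm_smul, Real.norm_of_nonneg hε0.le] at h1
      have e2 : (ε * ‖x - y‖) ^ 2 / (2 * (ε / ρ)) = ρ / 2 * ε * ‖x - y‖ ^ 2 := by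
        field_simp
      rw [e2] at h1
      have h2 := mul_le_mul_of_nonneg_left h1 hε1.le
      linarith
  rw [lintegral_one, measure_univ, ENNReal.one_rpow, mul_one,
    ← ofReal_integral_eq_lintegral_ofReal, ← ofReal_integral_eq_lintegral_ofReal,
    ENNReal.ofReal_rpow_of_nonneg (integral_nonneg fun x => (Real.exp_pos _).le) hε1.le,
    ENNReal.ofReal_le_ofReal_iff (integral_nonneg fun x => (Real.exp_pos _).le)] at key
  · exact key
  · refine integrable_of_bound (by fun_prop) (M := Real.exp |M|) fun x => ?_
    rw [abs_of_pos (Real.exp_pos _), Real.exp_le_exp]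
    have h1 := hQM x
    have h2 := le_abs_self M
    have h3 := abs_nonneg M
    nlinarith
  · exact Filter.Eventually.of_forall fun x => (Real.exp_pos _).le
  · have := hg.measurable
    refine integrable_of_bound (by fun_prop) (M := Real.exp M) fun x => ?_
    rw [abs_of_pos (Real.exp_pos _), Real.exp_le_exp]
    exact hM' x
  · exact Filter.Eventually.of_forall fun x => (Real.exp_pos _).le

theorem exp_mul_sub_one_le {ε w : ℝ} (h : |ε * w| ≤ 1) :
    Real.exp (ε * w) - 1 ≤ ε * (w + ε * w ^ 2) := by
  have := (abs_le.1 (Real.abs_exp_sub_one_sub_id_le h)).2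
  linarith [this, (by ring : ε * (w + ε * w ^ 2) = ε * w + (ε * w) ^ 2)]

theorem GaussianPrekopaLeindler.entropy_exp_le {n : ℕ} {ν : Measure (En n)}
    [IsProbabilityMeasure ν] {ρ : ℝ} (hρ : 0 < ρ) (hν : GaussianPrekopaLeindler ρ ν)
    {g : En n → ℝ} (hg : IsTestFun g) :
    (∫ x, Real.exp (g x) * g x ∂ν) -
        (∫ x, Real.exp (g x) ∂ν) * Real.log (∫ x, Real.exp (g x) ∂ν) ≤
      1 / (2 * ρ) * ∫ x, Real.exp (g x) * ‖gradient g x‖ ^ 2 ∂ν := by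
  obtain ⟨M, hM0, hM⟩ := hg.exists_bound
  obtain ⟨L, hL0, hL, hLg⟩ := hg.exists_lipschitz
  have hgc := hg.continuous
  have hgm := hgc.measurable
  have hGm := hg.continuous_norm_gradient.measurable
  have hM' : ∀ x, g x ≤ M := fun x => (le_abs_self _).trans (hM x)
  have heM : ∀ x, |Real.exp (g x)| ≤ Real.exp M := fun x => by
    rw [abs_of_pos (Real.exp_pos _), Real.exp_le_exp]; exact hM' x
  have hei : Integrable (fun x => Real.exp (g x)) ν := integrable_of_bound (by fun_prop) heM
  set E := ∫ x, Real.exp (g x) ∂ν with hE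
  have hE0 : 0 < E := integral_exp_pos hei
  set ε : ℕ → ℝ := fun k => 1 / ((k : ℝ) + 1) / 2 with hεd
  have hε0 : ∀ k, 0 < ε k := fun k => by positivity
  have hε1 : ∀ k, ε k < 1 := fun k => by
    have h1 : 1 / ((k : ℝ) + 1) ≤ 1 := by
      rw [div_le_one (by positivity)]; linarith [(Nat.cast_nonneg k : (0 : ℝ) ≤ k)]
    simp only [hεd]; linarith
  have hεlim : Filter.Tendsto ε Filter.atTop (nhds 0) := by
    have := (tendsto_one_div_add_atTop_nhds_zero_nat (𝕜 := ℝ)).div_const 2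
    simpa [hεd] using this
  set Q : ℕ → En n → ℝ := fun k => supConv g (ε k / ρ) with hQ
  have hs0 : ∀ k, 0 < ε k / ρ := fun k => div_pos (hε0 k) hρ
  have hQm : ∀ k, Measurable (Q k) := fun k => measurable_supConv hgc hM' (hs0 k).le
  have hQM : ∀ k x, Q k x ≤ M := fun k x => ciSup_le fun v => by
    have : 0 ≤ ‖v‖ ^ 2 / (2 * (ε k / ρ)) := by have := hs0 k; positivity
    linarith [hM' (x + v)]
  have hQg : ∀ k x, g x ≤ Q k x := fun k x => by
    simpa using le_supConv hM' (hs0 k).le x 0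
  have hεQM : ∀ k x, (1 - ε k) * Q k x ≤ M := fun k x => by
    nlinarith [hQM k x, hε0 k, hε1 k]
  have main : -(E * Real.log E) ≤
      ∫ x, Real.exp (g x) * (-g x + ‖gradient g x‖ ^ 2 / (2 * ρ)) ∂ν := by
    refine le_integral_of_eventually_le
      (G := fun k x => (Real.exp ((1 - ε k) * Q k x) - Real.exp (g x)) / ε k)
      (M := Real.exp M * (M + L ^ 2 / (2 * ρ))) (fun k => ?_) (by fun_prop) (fun k x => ?_)
      (fun x => ?_) (fun x η hη => ?_) fun k => ?_
    · have := hQm k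
      fun_prop
    · rw [abs_div, abs_of_pos (hε0 k), div_le_iff₀ (hε0 k)]
      refine (abs_exp_sub_exp_le (hεQM k x) (hM' x)).trans ?_
      rw [mul_assoc]
      refine mul_le_mul_of_nonneg_left ?_ (Real.exp_pos _).le
      have h1 : Q k x ≤ g x + ε k / ρ * L ^ 2 / 2 := supConv_le_add_lipschitz hL (hs0 k) x
      have h2 := hQg k x
      have h3 := hQM k x
      have h4 := (abs_le.1 (hM x)).1
      have h5 : ε k / ρ * L ^ 2 / 2 = L ^ 2 / (2 * ρ) * ε k := by field_simp
      have h6 : 0 ≤ L ^ 2 / (2 * ρ) * ε k := by have := hε0 k; positivity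
      rw [h5] at h1
      have h7 : |ε k * Q k x| ≤ ε k * M := by
        rw [abs_mul, abs_of_pos (hε0 k)]
        exact mul_le_mul_of_nonneg_left (abs_le.2 ⟨h4.trans h2, h3⟩) (hε0 k).le
      have h8 := abs_le.1 h7
      rw [abs_le]
      constructor
      · nlinarith
      · nlinarith
    · have h1 : ‖gradient g x‖ ^ 2 / (2 * ρ) ≤ L ^ 2 / (2 * ρ) := by
        have := hLg x
        gcongr
      have h2 : 0 ≤ ‖gradient g x‖ ^ 2 / (2 * ρ) := by positivity
      have h3 := abs_le.1 (hM x)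
      rw [abs_mul]
      refine mul_le_mul (heM x) (abs_le.2 ⟨by linarith, by linarith⟩) (abs_nonneg _)
        (Real.exp_pos _).le
    · set w : ℝ → ℝ := fun η' => -g x + (‖gradient g x‖ + η') ^ 2 / (2 * ρ) with hw
      have hc : Continuous fun η' => Real.exp (g x) * w η' := by fun_prop
      have hlt : Real.exp (g x) * w 0 <
          Real.exp (g x) * (-g x + ‖gradient g x‖ ^ 2 / (2 * ρ)) + η := by
        simp [hw, hη]
      obtain ⟨η', hη'0, hη'⟩ : ∃ η' > 0, Real.exp (g x) * w η' <
          Real.exp (g x) * (-g x + ‖gradient g x‖ ^ 2 / (2 * ρ)) + η := by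
        have h1 := hc.continuousAt.eventually_lt_const hlt
        obtain ⟨e, he, h2⟩ := Metric.eventually_nhds_iff.1 h1
        refine ⟨e / 2, half_pos he, h2 ?_⟩
        rw [dist_zero_right, Real.norm_of_nonneg (by positivity)]
        linarith
      obtain ⟨δ, hδ, hloc⟩ := Metric.eventually_nhds_iff.1
        (eventually_le_add_norm_gradient (hg.differentiable x) hη'0)
      have hl1 : Filter.Tendsto (fun k => 2 * L * (ε k / ρ)) Filter.atTop (nhds 0) := by
        simpa using (hεlim.div_const ρ).const_mul (2 * L)
      have hl2 : Filter.Tendsto (fun k => |ε k * w η'|) Filter.atTop (nhds 0) := by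
        simpa using (hεlim.mul_const (w η')).abs
      have hl3 : Filter.Tendsto (fun k => Real.exp (g x) * (w η' + ε k * w η' ^ 2)) Filter.atTop
          (nhds (Real.exp (g x) * w η')) := by
        simpa using ((hεlim.mul_const (w η' ^ 2)).const_add (w η')).const_mul (Real.exp (g x))
      filter_upwards [hl1.eventually_lt_const hδ, hl2.eventually_lt_const one_pos,
        hl3.eventually_lt_const hη'] with k hk1 hk2 hk3
      have h1 : Q k x ≤ g x + ε k / ρ * (‖gradient g x‖ + η') ^ 2 / 2 :=
        supConv_le_add_of_local hL (hs0 k) (fun v hv => hloc (by rwa [dist_zero_right])) hk1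
      have h2 : (1 - ε k) * Q k x ≤ g x + ε k * w η' := by
        have h3 : (1 - ε k) * Q k x ≤
            (1 - ε k) * (g x + ε k / ρ * (‖gradient g x‖ + η') ^ 2 / 2) :=
          mul_le_mul_of_nonneg_left h1 (by linarith [hε1 k])
        have h4 : 0 ≤ ε k * (ε k / ρ * (‖gradient g x‖ + η') ^ 2 / 2) := by
          have := hε0 k
          positivity
        have h5 : ε k * w η' = -(ε k * g x) + ε k / ρ * (‖gradient g x‖ + η') ^ 2 / 2 := by
          simp only [hw]; field_simp
        linarith
      rw [div_le_iff₀ (hε0 k)]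
      have h3 := Real.exp_le_exp.2 h2
      rw [Real.exp_add] at h3
      have h4 := mul_le_mul_of_nonneg_left (exp_mul_sub_one_le hk2.le) (Real.exp_pos (g x)).le
      have h5 := mul_le_mul_of_nonneg_left hk3.le (hε0 k).le
      linarith
    · have h1 := hν.rpow_integral_exp_le hρ hgc hM ⟨hε0 k, hε1 k⟩
      have h2 : E - ε k * (E * Real.log E) ≤ E ^ (1 - ε k) := by
        rw [Real.rpow_sub hE0, Real.rpow_one, div_eq_mul_inv, ← Real.rpow_neg hE0.le,
          Real.rpow_def_of_pos hE0]
        have := mul_le_mul_of_nonneg_left (Real.add_one_le_exp (Real.log E * -ε k)) hE0.le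
        linarith
      have hQi : Integrable (fun x => Real.exp ((1 - ε k) * Q k x)) ν := by
        have := hQm k
        refine integrable_of_bound (by fun_prop) (M := Real.exp M) fun x => ?_
        rw [abs_of_pos (Real.exp_pos _), Real.exp_le_exp]
        exact hεQM k x
      rw [integral_div, integral_sub hQi hei, le_div_iff₀ (hε0 k)]
      linarith
  have hi1 : Integrable (fun x => Real.exp (g x) * g x) ν :=
    integrable_of_bound (by fun_prop) (M := Real.exp M * M) fun x => by
      rw [abs_mul]
      exact mul_le_mul (heM x) (hM x) (abs_nonneg _) (Real.exp_pos _).le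
  have hi2 : Integrable (fun x => Real.exp (g x) * ‖gradient g x‖ ^ 2) ν :=
    integrable_of_bound (by fun_prop) (M := Real.exp M * L ^ 2) fun x => by
      rw [abs_mul, abs_of_nonneg (sq_nonneg ‖gradient g x‖)]
      exact mul_le_mul (heM x) (pow_le_pow_left₀ (norm_nonneg _) (hLg x) 2) (by positivity)
        (Real.exp_pos _).le
  have e : ∫ x, Real.exp (g x) * (-g x + ‖gradient g x‖ ^ 2 / (2 * ρ)) ∂ν =
      1 / (2 * ρ) * (∫ x, Real.exp (g x) * ‖gradient g x‖ ^ 2 ∂ν) -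
        ∫ x, Real.exp (g x) * g x ∂ν := by
    rw [← integral_const_mul, ← integral_sub (hi2.const_mul _) hi1]
    congr 1
    ext x
    ring
  linarith

theorem isTestFun_of_norm_gradient_le {n : ℕ} {f : En n → ℝ} (hf : ContDiff ℝ (⊤ : ℕ∞) f) {M L : ℝ}
    (hM : ∀ x, |f x| ≤ M) (hL : ∀ x, ‖gradient f x‖ ≤ L) : IsTestFun f := by
  refine ⟨hf, ⟨M, hM⟩, L.toNNReal,
    lipschitzWith_of_nnnorm_fderiv_le (𝕜 := ℝ) (hf.differentiable (by simp)) fun x => ?_⟩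
  rw [← NNReal.coe_le_coe, coe_nnnorm, ← norm_gradient_eq]
  exact (hL x).trans (Real.le_coe_toNNReal L)

theorem norm_gradient_const_mul_sub {n : ℕ} {f : En n → ℝ} (hf : Differentiable ℝ f) (t m : ℝ)
    (x : En n) : ‖gradient (fun y => t * (f y - m)) x‖ = |t| * ‖gradient f x‖ := by
  rw [norm_gradient_eq, norm_gradient_eq, fderiv_const_mul ((hf x).sub_const m), fderiv_sub_const,
    norm_smul, Real.norm_eq_abs]

theorem exp_le_of_abs_le_eighth {u : ℝ} (hu : |u| ≤ 1 / 8) :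
    Real.exp u ≤ 1 + u + 5 / 8 * u ^ 2 := by
  have h1 := (abs_le.1 (Real.exp_bound (hu.trans (by norm_num)) (n := 3) (by norm_num))).2
  norm_num [Finset.sum_range_succ, Nat.factorial] at h1
  have h2 : |u| ^ 3 ≤ 1 / 8 * u ^ 2 := by
    rw [pow_succ, sq_abs, mul_comm]
    exact mul_le_mul_of_nonneg_right hu (sq_nonneg u)
  nlinarith [sq_nonneg u]

theorem le_exp_mul_self_of_abs_le_eighth {u : ℝ} (hu : |u| ≤ 1 / 8) :
    u + 3 / 4 * u ^ 2 ≤ Real.exp u * u := by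
  rcases le_total 0 u with h | h
  · nlinarith [Real.add_one_le_exp u]
  · have h1 := exp_le_of_abs_le_eighth hu
    have h2 := (abs_le.1 hu).1
    nlinarith [mul_nonneg (sq_nonneg u) (neg_nonneg.2 h),
      mul_nonneg (sq_nonneg u) (by linarith : 0 ≤ u + 1 / 8)]

theorem GaussianPrekopaLeindler.poincareLE {n : ℕ} {ν : Measure (En n)}
    [IsProbabilityMeasure ν] {ρ : ℝ} (hρ : 0 < ρ) (hν : GaussianPrekopaLeindler ρ ν) :
    PoincareLE ν (6 / ρ) := by
  intro f hf
  obtain ⟨M, hM0, hM⟩ := hf.exists_bound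
  obtain ⟨L, hL0, -, hLg⟩ := hf.exists_lipschitz
  set m := ∫ x, f x ∂ν with hm
  have hmM : |m| ≤ M := by
    have := norm_integral_le_of_norm_le_const (μ := ν) (f := f) (Filter.Eventually.of_forall hM)
    simpa using this
  set t := 1 / (16 * M) with ht
  have ht0 : 0 < t := by positivity
  set g : En n → ℝ := fun x => t * (f x - m) with hgd
  have hu : ∀ x, |g x| ≤ 1 / 8 := fun x => by
    have h1 : |f x - m| ≤ 2 * M := (abs_sub _ _).trans (by linarith [hM x])
    rw [hgd, abs_mul, abs_of_pos ht0]
    calc t * |f x - m| ≤ t * (2 * M) := mul_le_mul_of_nonneg_left h1 ht0.le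
      _ = 1 / 8 := by rw [ht]; field_simp; norm_num
  have hgrad : ∀ x, ‖gradient g x‖ = t * ‖gradient f x‖ := fun x => by
    rw [hgd, norm_gradient_const_mul_sub hf.differentiable, abs_of_pos ht0]
  have hg : IsTestFun g := isTestFun_of_norm_gradient_le
    (contDiff_const.mul (hf.1.sub contDiff_const)) hu (L := t * L) fun x => by
      rw [hgrad]; exact mul_le_mul_of_nonneg_left (hLg x) ht0.le
  have hgm := hg.continuous.measurable
  have hgi := hg.integrable ν
  have hg2i := hg.integrable_sq ν
  have hexp : ∀ x, Real.exp (g x) ≤ 57 / 50 := fun x => by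
    have h1 := exp_le_of_abs_le_eighth (hu x)
    have h2 := abs_le.1 (hu x)
    nlinarith
  have hei : Integrable (fun x => Real.exp (g x)) ν :=
    integrable_of_bound (by fun_prop) (M := 57 / 50) fun x => by
      rw [abs_of_pos (Real.exp_pos _)]; exact hexp x
  have hegi : Integrable (fun x => Real.exp (g x) * g x) ν :=
    integrable_of_bound (by fun_prop) (M := 57 / 50 * (1 / 8)) fun x => by
      rw [abs_mul, abs_of_pos (Real.exp_pos _)]
      exact mul_le_mul (hexp x) (hu x) (abs_nonneg _) (by norm_num)
  have hg0 : ∫ x, g x ∂ν = 0 := by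
    rw [hgd, integral_const_mul, integral_sub (hf.integrable ν) (integrable_const _)]
    simp [hm]
  set A := ∫ x, g x ^ 2 ∂ν with hA
  have hA0 : 0 ≤ A := integral_nonneg fun x => sq_nonneg _
  have hA1 : A ≤ 1 / 64 := by
    have := integral_mono hg2i (integrable_const (1 / 64 : ℝ)) fun x => by
      have h2 := abs_le.1 (hu x)
      change g x ^ 2 ≤ 1 / 64
      nlinarith
    simpa using this
  set E := ∫ x, Real.exp (g x) ∂ν with hE
  have hE1 : 1 ≤ E := by
    have := integral_mono ((integrable_const (1 : ℝ)).add hgi) hei fun x => by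
      have := Real.add_one_le_exp (g x)
      change 1 + g x ≤ Real.exp (g x)
      linarith
    change ∫ x, (1 + g x) ∂ν ≤ E at this
    rw [integral_add (integrable_const _) hgi, hg0] at this
    simpa using this
  have hE2 : E ≤ 1 + 5 / 8 * A := by
    have hi : Integrable (fun x => 1 + g x) ν := (integrable_const (1 : ℝ)).add hgi
    have := integral_mono hei (hi.add (hg2i.const_mul (5 / 8))) fun x =>
      exp_le_of_abs_le_eighth (hu x)
    change E ≤ ∫ x, (1 + g x + 5 / 8 * g x ^ 2) ∂ν at this
    rw [integral_add hi (hg2i.const_mul _), integral_add (integrable_const _) hgi, hg0,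
      integral_const_mul] at this
    simpa using this
  have hent : 3 / 4 * A ≤ ∫ x, Real.exp (g x) * g x ∂ν := by
    have := integral_mono (hgi.add (hg2i.const_mul (3 / 4))) hegi fun x =>
      le_exp_mul_self_of_abs_le_eighth (hu x)
    change ∫ x, (g x + 3 / 4 * g x ^ 2) ∂ν ≤ _ at this
    rw [integral_add hgi (hg2i.const_mul _), hg0, integral_const_mul, zero_add] at this
    exact this
  have hlog : E * Real.log E ≤ 16 / 25 * A := by
    have h1 := Real.log_le_sub_one_of_pos (by linarith : 0 < E)
    have h2 : E * Real.log E ≤ E * (E - 1) := mul_le_mul_of_nonneg_left h1 (by linarith)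
    nlinarith
  have hD : ∫ x, Real.exp (g x) * ‖gradient g x‖ ^ 2 ∂ν ≤
      57 / 50 * t ^ 2 * ∫ x, ‖gradient f x‖ ^ 2 ∂ν := by
    rw [← integral_const_mul]
    refine integral_mono_of_nonneg (Filter.Eventually.of_forall fun x => by positivity)
      ((hf.integrable_norm_gradient_sq ν).const_mul _) (Filter.Eventually.of_forall fun x => ?_)
    change Real.exp (g x) * ‖gradient g x‖ ^ 2 ≤ 57 / 50 * t ^ 2 * ‖gradient f x‖ ^ 2
    rw [hgrad, mul_pow, mul_assoc]
    exact mul_le_mul_of_nonneg_right (hexp x) (by positivity)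
  have hlsi := hν.entropy_exp_le hρ hg
  have hA2 : A = t ^ 2 * ∫ x, (f x - m) ^ 2 ∂ν := by
    rw [hA, ← integral_const_mul]
    congr 1
    ext x
    rw [hgd]
    ring
  refine (variance_le_integral_sub_sq (hf.integrable ν) (hf.integrable_sq ν) m).trans ?_
  set D := ∫ x, ‖gradient f x‖ ^ 2 ∂ν with hDd
  have hD0 : 0 ≤ D := integral_nonneg fun x => by positivity
  have h1 := mul_le_mul_of_nonneg_left hD (by positivity : 0 ≤ 1 / (2 * ρ))
  have h2 : 1 / (2 * ρ) * (57 / 50 * t ^ 2 * D) = 57 / 100 * (t ^ 2 * (D / ρ)) := by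
    ring
  have h3 : 0 ≤ t ^ 2 * (D / ρ) := by positivity
  have h4 : A ≤ 6 * (t ^ 2 * (D / ρ)) := by linarith
  have h5 : 6 / ρ * D = 6 * (D / ρ) := by ring
  rw [h5]
  refine le_of_mul_le_mul_left ?_ (by positivity : 0 < t ^ 2)
  rw [← hA2]
  linarith

/-- The dual (Donsker–Varadhan) bound for the relative entropy of `exp g`. -/
theorem integral_exp_mul_le_entropy {E : Type*} [MeasurableSpace E] {ν : Measure E}
    [IsProbabilityMeasure ν] {g G : E → ℝ} (hg : Integrable (fun x => Real.exp (g x)) ν)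
    (hgg : Integrable (fun x => Real.exp (g x) * g x) ν)
    (hgG : Integrable (fun x => Real.exp (g x) * G x) ν)
    (hG : Integrable (fun x => Real.exp (G x)) ν) :
    ∫ x, Real.exp (g x) * G x ∂ν ≤ (∫ x, Real.exp (g x) * g x ∂ν) -
      (∫ x, Real.exp (g x) ∂ν) * Real.log (∫ x, Real.exp (g x) ∂ν) +
      (∫ x, Real.exp (g x) ∂ν) * Real.log (∫ x, Real.exp (G x) ∂ν) := by
  set I := ∫ x, Real.exp (g x) ∂ν with hI
  set K := ∫ x, Real.exp (G x) ∂ν with hK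
  have hI0 : 0 < I := integral_exp_pos hg
  have hK0 : 0 < K := integral_exp_pos hG
  set c := Real.log I - Real.log K + 1 with hc
  have hpt : ∀ x, Real.exp (g x) * G x ≤
      Real.exp (g x) * g x - c * Real.exp (g x) + I / K * Real.exp (G x) := by
    intro x
    have h1 := Real.add_one_le_exp (G x - g x + (Real.log I - Real.log K))
    have h2 := mul_le_mul_of_nonneg_left h1 (Real.exp_pos (g x)).le
    have h3 : Real.exp (g x) * Real.exp (G x - g x + (Real.log I - Real.log K)) =
        I / K * Real.exp (G x) := by
      rw [← Real.log_div hI0.ne' hK0.ne', Real.exp_add, Real.exp_log (by positivity), Real.exp_sub]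
      field_simp
    rw [h3] at h2
    rw [hc]
    linarith
  have hi1 : Integrable (fun x => Real.exp (g x) * g x - c * Real.exp (g x)) ν :=
    hgg.sub (hg.const_mul c)
  have := integral_mono hgG (hi1.add (hG.const_mul (I / K))) hpt
  refine this.trans (le_of_eq ?_)
  change ∫ x, (Real.exp (g x) * g x - c * Real.exp (g x) + I / K * Real.exp (G x)) ∂ν = _
  rw [integral_add hi1 (hG.const_mul _), integral_sub hgg (hg.const_mul c), integral_const_mul,
    integral_const_mul, ← hI, ← hK, div_mul_cancel₀ _ hK0.ne', hc]
  ring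

theorem exp_neg_le_integral_exp_neg_norm_sq {n : ℕ} {μ : Measure (En n)} [IsProbabilityMeasure μ]
    (h : ∀ i : Fin n, ∫ x, x i * x i ∂μ = 1) {c : ℝ} (hc : 0 ≤ c) :
    Real.exp (-(c * n)) ≤ ∫ x, Real.exp (-(c * ‖x‖ ^ 2)) ∂μ := by
  have hi := integrable_norm_sq_of_isotropic h
  set a := Real.exp (-(c * n)) with ha
  have hpt : ∀ x : En n, a * (1 + c * n) - a * c * ‖x‖ ^ 2 ≤ Real.exp (-(c * ‖x‖ ^ 2)) := by
    intro x
    have h1 := Real.add_one_le_exp (c * n - c * ‖x‖ ^ 2)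
    have h2 := mul_le_mul_of_nonneg_left h1 (Real.exp_pos (-(c * n))).le
    rw [← Real.exp_add, ← ha] at h2
    have h3 : -(c * n) + (c * n - c * ‖x‖ ^ 2) = -(c * ‖x‖ ^ 2) := by ring
    rw [h3] at h2
    linarith
  have := integral_mono ((integrable_const _).sub (hi.const_mul (a * c)))
    (integrable_exp_neg_norm_sq μ hc) hpt
  refine le_trans (le_of_eq ?_) this
  change _ = ∫ x, (a * (1 + c * n) - a * c * ‖x‖ ^ 2) ∂μ
  rw [integral_sub (integrable_const _) (hi.const_mul _), integral_const_mul, integral_const_mul,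
    integral_norm_sq_of_isotropic h]
  simp
  ring

theorem integrable_exp_norm_sq_perturb {n : ℕ} (μ : Measure (En n)) [IsProbabilityMeasure μ]
    {ρ : ℝ} (hρ : 0 ≤ ρ) :
    Integrable (fun x => Real.exp (ρ / 4 * ‖x‖ ^ 2)) (perturb μ fun x => ρ / 2 * ‖x‖ ^ 2) := by
  rw [integrable_perturb_iff μ (integrable_exp_neg_norm_sq μ (by positivity))]
  refine (integrable_exp_neg_norm_sq μ (by positivity : 0 ≤ ρ / 4)).congr
    (Filter.Eventually.of_forall fun x => ?_)
  simp only
  rw [← Real.exp_add]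
  ring_nf

theorem log_integral_exp_norm_sq_perturb_le {n : ℕ} {μ : Measure (En n)} [IsProbabilityMeasure μ]
    (h : ∀ i : Fin n, ∫ x, x i * x i ∂μ = 1) {ρ : ℝ} (hρ : 0 ≤ ρ) :
    Real.log (∫ x, Real.exp (ρ / 4 * ‖x‖ ^ 2) ∂(perturb μ fun x => ρ / 2 * ‖x‖ ^ 2)) ≤
      ρ / 4 * n := by
  have hρ2 : 0 ≤ ρ / 2 := by positivity
  have hρ4 : 0 ≤ ρ / 4 := by positivity
  have hZi := integrable_exp_neg_norm_sq μ hρ2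
  have hmi := integrable_exp_neg_norm_sq μ hρ4
  rw [integral_perturb μ hZi]
  have e : ∀ x : En n, Real.exp (-(ρ / 2 * ‖x‖ ^ 2)) * Real.exp (ρ / 4 * ‖x‖ ^ 2) =
      Real.exp (-(ρ / 4 * ‖x‖ ^ 2)) := fun x => by rw [← Real.exp_add]; ring_nf
  simp only [e]
  set Z := ∫ x, Real.exp (-(ρ / 2 * ‖x‖ ^ 2)) ∂μ with hZ
  set m := ∫ x, Real.exp (-(ρ / 4 * ‖x‖ ^ 2)) ∂μ with hm
  have hZ0 : 0 < Z := integral_exp_pos hZi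
  have hm0 : 0 < m := integral_exp_pos hmi
  have e2 : ∀ x : En n, Real.exp (-(ρ / 4 * ‖x‖ ^ 2)) ^ 2 = Real.exp (-(ρ / 2 * ‖x‖ ^ 2)) :=
    fun x => by rw [← Real.exp_nat_mul]; congr 1; push_cast; ring
  have hmZ : m ^ 2 ≤ Z := by
    have h1 := variance_le_integral_sub_sq (μ := μ) hmi (by simpa only [e2] using hZi) 0
    have h2 : 0 ≤ ∫ x, (Real.exp (-(ρ / 4 * ‖x‖ ^ 2)) - m) ^ 2 ∂μ :=
      integral_nonneg fun x => sq_nonneg _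
    have h3 : ∀ x : En n, (Real.exp (-(ρ / 4 * ‖x‖ ^ 2)) - m) ^ 2 =
        Real.exp (-(ρ / 2 * ‖x‖ ^ 2)) - 2 * m * Real.exp (-(ρ / 4 * ‖x‖ ^ 2)) + m ^ 2 := fun x => by
      rw [← e2]; ring
    have hi : Integrable (fun x => Real.exp (-(ρ / 2 * ‖x‖ ^ 2)) -
      2 * m * Real.exp (-(ρ / 4 * ‖x‖ ^ 2))) μ := hZi.sub (hmi.const_mul _)
    simp only [h3] at h2
    rw [integral_add hi (integrable_const _), integral_sub hZi (hmi.const_mul _),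
      integral_const_mul] at h2
    simp only [integral_const, probReal_univ, one_smul, ← hZ, ← hm] at h2
    linarith
  have hZ1 : -(ρ / 2 * n) ≤ Real.log Z := by
    rw [Real.le_log_iff_exp_le hZ0]
    exact exp_neg_le_integral_exp_neg_norm_sq h hρ2
  have hlm : 2 * Real.log m ≤ Real.log Z := by
    have := Real.log_le_log (by positivity) hmZ
    rwa [Real.log_pow, Nat.cast_ofNat] at this
  rw [Real.log_mul (by positivity) hm0.ne', Real.log_inv]
  linarith

theorem integrable_norm_sq_perturb {n : ℕ} {μ : Measure (En n)} [IsProbabilityMeasure μ]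
    (h : ∀ i : Fin n, ∫ x, x i * x i ∂μ = 1) {ρ : ℝ} (hρ : 0 ≤ ρ) :
    Integrable (fun x => ‖x‖ ^ 2) (perturb μ fun x => ρ / 2 * ‖x‖ ^ 2) := by
  rw [integrable_perturb_iff μ (integrable_exp_neg_norm_sq μ (by positivity))]
  refine (integrable_norm_sq_of_isotropic h).mono' (by fun_prop)
    (Filter.Eventually.of_forall fun x => ?_)
  rw [Real.norm_of_nonneg (by positivity)]
  refine mul_le_of_le_one_left (by positivity) ?_
  rw [Real.exp_le_one_iff]
  have : 0 ≤ ρ / 2 * ‖x‖ ^ 2 := by positivity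
  linarith

theorem norm_gradient_log_sq_add {n : ℕ} {f : En n → ℝ} (hf : Differentiable ℝ f) (a : ℝ) {η : ℝ}
    (hη : 0 < η) (x : En n) :
    ‖gradient (fun y => Real.log ((f y - a) ^ 2 + η)) x‖ =
      2 * |f x - a| / ((f x - a) ^ 2 + η) * ‖gradient f x‖ := by
  have h0 : 0 < (f x - a) ^ 2 + η := by positivity
  have h1 := ((((hf x).hasFDerivAt.sub_const a).pow 2).add_const η).log h0.ne'
  rw [norm_gradient_eq, norm_gradient_eq, h1.fderiv, smul_smul, norm_smul, Real.norm_eq_abs,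
    abs_mul, abs_inv, abs_of_pos h0]
  congr 1
  simp
  field_simp

theorem GaussianPrekopaLeindler.integral_sq_mul_norm_sq_le {n : ℕ} {μ : Measure (En n)}
    [IsProbabilityMeasure μ] (h : ∀ i : Fin n, ∫ x, x i * x i ∂μ = 1) {ρ : ℝ} (hρ : 0 < ρ)
    (hν : GaussianPrekopaLeindler ρ (perturb μ fun x => ρ / 2 * ‖x‖ ^ 2)) {f : En n → ℝ}
    (hf : IsTestFun f) (a : ℝ) :
    ∫ x, (f x - a) ^ 2 * ‖x‖ ^ 2 ∂(perturb μ fun x => ρ / 2 * ‖x‖ ^ 2) ≤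
      n * ∫ x, (f x - a) ^ 2 ∂(perturb μ fun x => ρ / 2 * ‖x‖ ^ 2) +
      8 / ρ ^ 2 * ∫ x, ‖gradient f x‖ ^ 2 ∂(perturb μ fun x => ρ / 2 * ‖x‖ ^ 2) := by
  have hK := log_integral_exp_norm_sq_perturb_le h hρ.le
  have hGi := integrable_exp_norm_sq_perturb μ hρ.le
  have hni := integrable_norm_sq_perturb h hρ.le
  have hνp := isProbabilityMeasure_perturb μ
    (integrable_exp_neg_norm_sq μ (by positivity : 0 ≤ ρ / 2))
  set ν := perturb μ fun x => ρ / 2 * ‖x‖ ^ 2 with hνd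
  obtain ⟨M, hM0, hM⟩ := hf.exists_bound
  obtain ⟨L, hL0, -, hLg⟩ := hf.exists_lipschitz
  have hfm := hf.continuous.measurable
  set N := M + |a| with hN
  have hN0 : 0 < N := by positivity
  have hfa : ∀ x, |f x - a| ≤ N := fun x => (abs_sub _ _).trans (by linarith [hM x])
  have hfa2 : ∀ x, (f x - a) ^ 2 ≤ N ^ 2 := fun x => sq_le_sq' (by linarith [(abs_le.1 (hfa x)).1])
    (abs_le.1 (hfa x)).2
  have hhi := hf.integrable_sub_sq ν a
  have hDi := hf.integrable_norm_gradient_sq ν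
  set D := ∫ x, ‖gradient f x‖ ^ 2 ∂ν with hD
  set H := ∫ x, (f x - a) ^ 2 ∂ν with hH
  refine le_of_forall_pos_le_add fun θ hθ => ?_
  obtain ⟨η, hη0, hη⟩ : ∃ η > 0, n * η ≤ θ :=
    ⟨θ / (n + 1), by positivity, by
      rw [mul_div_assoc', div_le_iff₀ (by positivity)]; nlinarith⟩
  set φ : En n → ℝ := fun x => (f x - a) ^ 2 + η with hφ
  have hφ0 : ∀ x, 0 < φ x := fun x => by positivity
  set g : En n → ℝ := fun x => Real.log (φ x) with hgd
  have hexp : ∀ x, Real.exp (g x) = φ x := fun x => Real.exp_log (hφ0 x)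
  have hgb : ∀ x, |g x| ≤ |Real.log η| + |Real.log (N ^ 2 + η)| := fun x => by
    have h1 : Real.log η ≤ g x := Real.log_le_log hη0 (by simp only [hφ]; nlinarith [sq_nonneg (f x - a)])
    have h2 : g x ≤ Real.log (N ^ 2 + η) := Real.log_le_log (hφ0 x) (by
      simp only [hφ]; linarith [hfa2 x])
    rw [abs_le]
    constructor
    · linarith [neg_abs_le (Real.log η), abs_nonneg (Real.log (N ^ 2 + η))]
    · linarith [le_abs_self (Real.log (N ^ 2 + η)), abs_nonneg (Real.log η)]
  have hgrad : ∀ x, ‖gradient g x‖ = 2 * |f x - a| / φ x * ‖gradient f x‖ := fun x =>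
    norm_gradient_log_sq_add hf.differentiable a hη0 x
  have hg : IsTestFun g := by
    refine isTestFun_of_norm_gradient_le
      ((((hf.1.sub contDiff_const).pow 2).add contDiff_const).log fun x => (hφ0 x).ne') hgb
      (L := 2 * N / η * L) fun x => ?_
    rw [hgrad]
    have h1 : η ≤ φ x := by simp only [hφ]; nlinarith [sq_nonneg (f x - a)]
    have h2 := hfa x
    have h3 := hLg x
    gcongr
  have hφi : Integrable φ ν := hhi.add (integrable_const η)
  have hgm := hg.continuous.measurable
  have hφm : Measurable φ := by fun_prop
  have hφb : ∀ x, |φ x| ≤ N ^ 2 + η := fun x => by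
    rw [abs_of_pos (hφ0 x)]; simp only [hφ]; linarith [hfa2 x]
  have hφg : Integrable (fun x => φ x * g x) ν := integrable_of_bound (by fun_prop)
    (M := (N ^ 2 + η) * (|Real.log η| + |Real.log (N ^ 2 + η)|)) fun x => by
      rw [abs_mul]
      exact mul_le_mul (hφb x) (hgb x) (abs_nonneg _) (by positivity)
  have hφn : Integrable (fun x => φ x * ‖x‖ ^ 2) ν :=
    hni.bdd_mul hφm.aestronglyMeasurable (Filter.Eventually.of_forall hφb)
  have hφG : Integrable (fun x => φ x * (ρ / 4 * ‖x‖ ^ 2)) ν := by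
    convert hφn.const_mul (ρ / 4) using 2
    ring
  have h1 := hν.entropy_exp_le hρ hg
  have h2 := integral_exp_mul_le_entropy (ν := ν) (g := g) (G := fun x => ρ / 4 * ‖x‖ ^ 2)
    (by simpa only [hexp] using hφi) (by simpa only [hexp] using hφg)
    (by simpa only [hexp] using hφG) hGi
  simp only [hexp] at h1 h2
  have h3 : ∫ x, φ x * ‖gradient g x‖ ^ 2 ∂ν ≤ 4 * D := by
    rw [hD, ← integral_const_mul]
    refine integral_mono_of_nonneg (Filter.Eventually.of_forall fun x => ?_) (hDi.const_mul 4)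
      (Filter.Eventually.of_forall fun x => ?_)
    · have := hφ0 x
      positivity
    · change φ x * ‖gradient g x‖ ^ 2 ≤ 4 * ‖gradient f x‖ ^ 2
      have e : φ x * ‖gradient g x‖ ^ 2 = (f x - a) ^ 2 / φ x * (4 * ‖gradient f x‖ ^ 2) := by
        have := (hφ0 x).ne'
        rw [hgrad, mul_pow, div_pow, mul_pow, sq_abs]
        field_simp
        ring
      rw [e]
      refine mul_le_of_le_one_left (by positivity) ?_
      rw [div_le_one (hφ0 x)]
      simp only [hφ]
      linarith
  have hI : ∫ x, φ x ∂ν = H + η := by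
    rw [hφ, integral_add hhi (integrable_const _)]
    simp [hH]
  have e4 : ∫ x, φ x * (ρ / 4 * ‖x‖ ^ 2) ∂ν = ρ / 4 * ∫ x, φ x * ‖x‖ ^ 2 ∂ν := by
    rw [← integral_const_mul]
    congr 1
    ext x
    ring
  have h5 : ∫ x, (f x - a) ^ 2 * ‖x‖ ^ 2 ∂ν ≤ ∫ x, φ x * ‖x‖ ^ 2 ∂ν :=
    integral_mono_of_nonneg (Filter.Eventually.of_forall fun x => by positivity) hφn
      (Filter.Eventually.of_forall fun x => mul_le_mul_of_nonneg_right
        (by simp only [hφ]; linarith) (sq_nonneg _))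
  have hH0 : 0 ≤ H := integral_nonneg fun x => sq_nonneg _
  rw [e4, hI] at h2
  rw [hI] at h1
  have h6 := mul_le_mul_of_nonneg_left hK (by linarith : 0 ≤ H + η)
  have h7 := mul_le_mul_of_nonneg_left h3 (by positivity : 0 ≤ 1 / (2 * ρ))
  have h8 : ρ / 4 * ∫ x, φ x * ‖x‖ ^ 2 ∂ν ≤ 1 / (2 * ρ) * (4 * D) + (H + η) * (ρ / 4 * n) := by
    linarith
  have h9 : 1 / (2 * ρ) * (4 * D) + (H + η) * (ρ / 4 * n) =
      ρ / 4 * (n * H + 8 / ρ ^ 2 * D + n * η) := by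
    field_simp; ring
  rw [h9] at h8
  have h10 := le_of_mul_le_mul_left h8 (by positivity)
  linarith

theorem hasFDerivAt_exp_neg_norm_sq {n : ℕ} (c : ℝ) (x : En n) :
    HasFDerivAt (fun y : En n => Real.exp (-(c * ‖y‖ ^ 2)))
      (Real.exp (-(c * ‖x‖ ^ 2)) • -(c • ((2 : ℕ) • (innerSL ℝ x : En n →L[ℝ] ℝ)))) x :=
  (((hasStrictFDerivAt_norm_sq x).hasFDerivAt.const_mul c).neg).exp

theorem norm_gradient_mul_exp_neg_le {n : ℕ} {f : En n → ℝ} (hf : Differentiable ℝ f) (a : ℝ)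
    {c : ℝ} (hc : 0 ≤ c) (x : En n) :
    ‖gradient (fun y => (f y - a) * Real.exp (-(c * ‖y‖ ^ 2))) x‖ ≤
      Real.exp (-(c * ‖x‖ ^ 2)) * (‖gradient f x‖ + |f x - a| * (2 * c * ‖x‖)) := by
  have h : HasFDerivAt (fun y => (f y - a) * Real.exp (-(c * ‖y‖ ^ 2))) _ x :=
    ((hf x).hasFDerivAt.sub_const a).mul (hasFDerivAt_exp_neg_norm_sq c x)
  rw [norm_gradient_eq, norm_gradient_eq, h.fderiv]
  refine (norm_add_le _ _).trans (le_of_eq ?_)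
  rw [norm_smul, norm_smul, norm_smul, norm_neg, norm_smul, ← Nat.cast_smul_eq_nsmul ℝ, norm_smul,
    innerSL_apply_norm, Real.norm_eq_abs, Real.norm_eq_abs, Real.norm_eq_abs, Real.norm_eq_abs,
    abs_of_pos (Real.exp_pos _), abs_of_nonneg hc]
  norm_num
  ring

theorem norm_mul_exp_neg_le {n : ℕ} {c : ℝ} (hc : 0 < c) (x : En n) :
    ‖x‖ * Real.exp (-(c * ‖x‖ ^ 2)) ≤ 1 + 1 / c := by
  have h1 := Real.add_one_le_exp (c * ‖x‖ ^ 2)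
  have h2 : ‖x‖ ≤ (1 + 1 / c) * (c * ‖x‖ ^ 2 + 1) := by
    have e : (1 + 1 / c) * (c * ‖x‖ ^ 2 + 1) = c * ‖x‖ ^ 2 + 1 + ‖x‖ ^ 2 + 1 / c := by
      field_simp; ring
    have : 0 ≤ c * ‖x‖ ^ 2 := by positivity
    have : 0 ≤ 1 / c := by positivity
    rw [e]
    nlinarith [sq_nonneg (‖x‖ - 1)]
  rw [Real.exp_neg, ← div_eq_mul_inv, div_le_iff₀ (Real.exp_pos _)]
  exact h2.trans (mul_le_mul_of_nonneg_left h1 (by positivity))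

theorem IsTestFun.sub_mul_exp_neg_norm_sq {n : ℕ} {f : En n → ℝ} (hf : IsTestFun f) (a : ℝ)
    {c : ℝ} (hc : 0 < c) : IsTestFun fun x => (f x - a) * Real.exp (-(c * ‖x‖ ^ 2)) := by
  obtain ⟨M, hM0, hM⟩ := hf.exists_bound
  obtain ⟨L, hL0, -, hLg⟩ := hf.exists_lipschitz
  have hfa : ∀ x, |f x - a| ≤ M + |a| := fun x => (abs_sub _ _).trans (by linarith [hM x])
  have he : ∀ x : En n, Real.exp (-(c * ‖x‖ ^ 2)) ≤ 1 := fun x => by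
    rw [Real.exp_le_one_iff]
    have : 0 ≤ c * ‖x‖ ^ 2 := by positivity
    linarith
  refine isTestFun_of_norm_gradient_le
    ((hf.1.sub contDiff_const).mul (contDiff_const.mul (contDiff_norm_sq ℝ)).neg.exp)
    (M := M + |a|) (L := L + (M + |a|) * (2 * c) * (1 + 1 / c)) (fun x => ?_) fun x => ?_
  · rw [abs_mul, abs_of_pos (Real.exp_pos _)]
    calc |f x - a| * Real.exp (-(c * ‖x‖ ^ 2)) ≤ (M + |a|) * 1 :=
          mul_le_mul (hfa x) (he x) (Real.exp_pos _).le (by positivity)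
      _ = _ := mul_one _
  · refine (norm_gradient_mul_exp_neg_le hf.differentiable a hc.le x).trans ?_
    have h1 : Real.exp (-(c * ‖x‖ ^ 2)) * ‖gradient f x‖ ≤ 1 * L :=
      mul_le_mul (he x) (hLg x) (norm_nonneg _) zero_le_one
    have h2 : |f x - a| * (2 * c) * (‖x‖ * Real.exp (-(c * ‖x‖ ^ 2))) ≤
        (M + |a|) * (2 * c) * (1 + 1 / c) := by
      have := hfa x
      have := norm_mul_exp_neg_le hc x
      gcongr
    linarith

theorem PoincareLE.integral_sub_sq_perturb_le {n : ℕ} {μ : Measure (En n)}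
    [IsProbabilityMeasure μ] {C ρ : ℝ} (hC : 0 ≤ C) (hμ : PoincareLE μ C) (hρ : 0 < ρ)
    (h2 : ∀ i : Fin n, ∫ x, x i * x i ∂μ = 1) {f : En n → ℝ} (hf : IsTestFun f) :
    ∃ a : ℝ, ∫ x, (f x - a) ^ 2 ∂(perturb μ fun x => ρ / 2 * ‖x‖ ^ 2) ≤
      2 * C * ∫ x, ‖gradient f x‖ ^ 2 ∂(perturb μ fun x => ρ / 2 * ‖x‖ ^ 2) +
      C * ρ ^ 2 / 2 *
        ∫ x, (f x - a) ^ 2 * ‖x‖ ^ 2 ∂(perturb μ fun x => ρ / 2 * ‖x‖ ^ 2) := by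
  have hρ4 : 0 < ρ / 4 := by positivity
  have hmi := integrable_exp_neg_norm_sq μ hρ4.le
  have hZi := integrable_exp_neg_norm_sq μ (by positivity : 0 ≤ ρ / 2)
  have hni := integrable_norm_sq_perturb h2 hρ.le
  have hνp := isProbabilityMeasure_perturb μ hZi
  obtain ⟨M, hM0, hM⟩ := hf.exists_bound
  have hfm := hf.continuous.measurable
  set m := ∫ x, Real.exp (-(ρ / 4 * ‖x‖ ^ 2)) ∂μ with hm
  have hm0 : 0 < m := integral_exp_pos hmi
  set a := (∫ x, f x * Real.exp (-(ρ / 4 * ‖x‖ ^ 2)) ∂μ) / m with ha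
  have hfei : Integrable (fun x => f x * Real.exp (-(ρ / 4 * ‖x‖ ^ 2))) μ :=
    hmi.bdd_mul hfm.aestronglyMeasurable (Filter.Eventually.of_forall hM)
  refine ⟨a, ?_⟩
  set g : En n → ℝ := fun x => (f x - a) * Real.exp (-(ρ / 4 * ‖x‖ ^ 2)) with hgd
  have hg : IsTestFun g := hf.sub_mul_exp_neg_norm_sq a hρ4
  have hg0 : ∫ x, g x ∂μ = 0 := by
    simp only [hgd, sub_mul]
    rw [integral_sub hfei (hmi.const_mul a), integral_const_mul, ← hm, ha,
      div_mul_cancel₀ _ hm0.ne', sub_self]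
  have h3 := hμ g hg
  rw [hg0] at h3
  have e2 : ∀ x : En n, Real.exp (-(ρ / 4 * ‖x‖ ^ 2)) ^ 2 = Real.exp (-(ρ / 2 * ‖x‖ ^ 2)) :=
    fun x => by rw [← Real.exp_nat_mul]; congr 1; push_cast; ring
  have hN0 : 0 ≤ M + |a| := by positivity
  have hfa2 : ∀ x, |(f x - a) ^ 2| ≤ (M + |a|) ^ 2 := fun x => by
    rw [abs_pow]
    exact pow_le_pow_left₀ (abs_nonneg _) ((abs_sub _ _).trans (by linarith [hM x])) 2
  have hhni : Integrable (fun x => (f x - a) ^ 2 * ‖x‖ ^ 2) (perturb μ fun x => ρ / 2 * ‖x‖ ^ 2) :=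
    hni.bdd_mul (by fun_prop) (Filter.Eventually.of_forall hfa2)
  have hDi := hf.integrable_norm_gradient_sq (perturb μ fun x => ρ / 2 * ‖x‖ ^ 2)
  have hpt : ∀ x, ‖gradient g x‖ ^ 2 ≤ Real.exp (-(ρ / 2 * ‖x‖ ^ 2)) *
      (2 * ‖gradient f x‖ ^ 2 + ρ ^ 2 / 2 * ((f x - a) ^ 2 * ‖x‖ ^ 2)) := fun x => by
    have h4 := pow_le_pow_left₀ (norm_nonneg _)
      (norm_gradient_mul_exp_neg_le hf.differentiable a hρ4.le x) 2
    rw [mul_pow, e2] at h4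
    refine h4.trans (mul_le_mul_of_nonneg_left ?_ (Real.exp_pos _).le)
    have h5 : (|f x - a| * (2 * (ρ / 4) * ‖x‖)) ^ 2 = ρ ^ 2 / 4 * ((f x - a) ^ 2 * ‖x‖ ^ 2) := by
      rw [mul_pow, sq_abs]; ring
    nlinarith [sq_nonneg (‖gradient f x‖ - |f x - a| * (2 * (ρ / 4) * ‖x‖))]
  have hi : Integrable (fun x => 2 * ‖gradient f x‖ ^ 2 + ρ ^ 2 / 2 * ((f x - a) ^ 2 * ‖x‖ ^ 2))
    (perturb μ fun x => ρ / 2 * ‖x‖ ^ 2) := (hDi.const_mul 2).add (hhni.const_mul _)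
  have h6 : ∫ x, ‖gradient g x‖ ^ 2 ∂μ ≤ ∫ x, Real.exp (-(ρ / 2 * ‖x‖ ^ 2)) *
      (2 * ‖gradient f x‖ ^ 2 + ρ ^ 2 / 2 * ((f x - a) ^ 2 * ‖x‖ ^ 2)) ∂μ :=
    integral_mono (hg.integrable_norm_gradient_sq μ) ((integrable_perturb_iff μ hZi _).1 hi) hpt
  have e3 : ∫ x, g x ^ 2 ∂μ = ∫ x, Real.exp (-(ρ / 2 * ‖x‖ ^ 2)) * (f x - a) ^ 2 ∂μ := by
    congr 1
    ext x
    rw [hgd, mul_pow, e2, mul_comm]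
  rw [e3] at h3
  have h7 : ∫ x, (f x - a) ^ 2 ∂(perturb μ fun x => ρ / 2 * ‖x‖ ^ 2) ≤ C * ∫ x,
      (2 * ‖gradient f x‖ ^ 2 + ρ ^ 2 / 2 * ((f x - a) ^ 2 * ‖x‖ ^ 2))
        ∂(perturb μ fun x => ρ / 2 * ‖x‖ ^ 2) := by
    rw [integral_perturb μ hZi, integral_perturb μ hZi, mul_left_comm]
    refine mul_le_mul_of_nonneg_left ?_ (inv_nonneg.2 (integral_exp_pos hZi).le)
    have := mul_le_mul_of_nonneg_left h6 hC
    linarith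
  rw [integral_add (hDi.const_mul 2) (hhni.const_mul _), integral_const_mul,
    integral_const_mul] at h7
  linarith

theorem PrekopaLeindler.poincareLE_perturb {n : ℕ} {μ : Measure (En n)}
    [IsProbabilityMeasure μ] (hPL : PrekopaLeindler μ) {C ρ : ℝ} (hC : 0 ≤ C)
    (hμ : PoincareLE μ C) (hρ : 0 < ρ) (h2 : ∀ i : Fin n, ∫ x, x i * x i ∂μ = 1)
    (hCρ : C * ρ ^ 2 * n ≤ 1) : PoincareLE (_root_.perturb μ fun x => ρ / 2 * ‖x‖ ^ 2) (12 * C) := by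
  intro f hf
  have hνp := isProbabilityMeasure_perturb μ
    (integrable_exp_neg_norm_sq μ (by positivity : 0 ≤ ρ / 2))
  obtain ⟨a, ha⟩ := hμ.integral_sub_sq_perturb_le hC hρ h2 hf
  have hm := (hPL.perturb ρ).integral_sq_mul_norm_sq_le h2 hρ hf a
  set ν := _root_.perturb μ fun x => ρ / 2 * ‖x‖ ^ 2
  refine (variance_le_integral_sub_sq (hf.integrable ν) (hf.integrable_sq ν) a).trans ?_
  have hH0 : 0 ≤ ∫ x, (f x - a) ^ 2 ∂ν := integral_nonneg fun x => sq_nonneg _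
  set H := ∫ x, (f x - a) ^ 2 ∂ν
  set D := ∫ x, ‖gradient f x‖ ^ 2 ∂ν
  have h3 := mul_le_mul_of_nonneg_left hm (by positivity : 0 ≤ C * ρ ^ 2 / 2)
  have h4 : C * ρ ^ 2 / 2 * (n * H + 8 / ρ ^ 2 * D) = C * ρ ^ 2 * n * H / 2 + 4 * C * D := by
    field_simp; ring
  have h5 := mul_le_mul_of_nonneg_right hCρ hH0
  linarith

theorem PoincareLE.mono {n : ℕ} {μ : Measure (En n)} {C C' : ℝ} (hμ : PoincareLE μ C)
    (h : C ≤ C') : PoincareLE μ C' := fun f hf =>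
  (hμ f hf).trans (mul_le_mul_of_nonneg_right h (integral_nonneg fun _ => sq_nonneg _))

theorem poincareLE_of_dim_zero {μ : Measure (En 0)} [IsProbabilityMeasure μ] {C : ℝ}
    (hC : 0 ≤ C) : PoincareLE μ C := by
  intro f _
  have hf : ∀ x, f x = f 0 := fun x => congrArg f (Subsingleton.elim _ _)
  simp only [hf, integral_const, probReal_univ, one_smul, sub_self]
  exact mul_nonneg hC (integral_nonneg fun _ => sq_nonneg _)

theorem perturb_zero {n : ℕ} (μ : Measure (En n)) [IsProbabilityMeasure μ] :
    (perturb μ fun _ => 0) = μ := by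
  simp [perturb]

theorem le_mul_rpow_of_pow_six_le {c K s t : ℝ} (hK : 0 ≤ K) (hs : 0 ≤ s) (ht : 0 ≤ t)
    (h : c ^ 6 ≤ K ^ 6 * (s ^ 2 * t) ^ 2) :
    c ≤ K * s ^ ((2 : ℝ) / 3) * t ^ ((1 : ℝ) / 3) := by
  have h1 : (s ^ ((2 : ℝ) / 3)) ^ 6 = s ^ 4 := by
    rw [← Real.rpow_mul_natCast hs, ← Real.rpow_natCast s 4]
    norm_num
  have h2 : (t ^ ((1 : ℝ) / 3)) ^ 6 = t ^ 2 := by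
    rw [← Real.rpow_mul_natCast ht, ← Real.rpow_natCast t 2]
    norm_num
  refine le_of_pow_le_pow_left₀ (n := 6) (by norm_num) (by positivity) (h.trans (le_of_eq ?_))
  rw [mul_pow (K * _), mul_pow K, h1, h2]
  ring

theorem PrekopaLeindler.exists_poincareLE_perturb {n : ℕ} (hn : 0 < n) {μ : Measure (En n)}
    [IsProbabilityMeasure μ] (hPL : PrekopaLeindler μ) {C ρ : ℝ} (hC : 0 ≤ C)
    (hμ : PoincareLE μ C) (hρ : 0 ≤ ρ) (h2 : ∀ i : Fin n, ∫ x, x i * x i ∂μ = 1) :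
    ∃ c : ℝ, c ^ 6 ≤ 393216 ^ 6 * ((n : ℝ) ^ 2 * C) ^ 2 ∧
      PoincareLE (_root_.perturb μ fun x => ρ / 2 * ‖x‖ ^ 2) c := by
  obtain ⟨D, hD0, hDC, hDn, hD⟩ : ∃ D : ℝ, 0 ≤ D ∧ D ≤ C ∧ D ≤ 32768 * n ∧ PoincareLE μ D := by
    rcases le_total C (32768 * n) with h | h
    · exact ⟨C, hC, le_rfl, h, hμ⟩
    · exact ⟨32768 * n, by positivity, h, le_rfl, hPL.poincareLE_of_isotropic hn h2⟩
  have hn0 : (0 : ℝ) ≤ n := n.cast_nonneg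
  have hD6 : D ^ 6 ≤ 32768 ^ 4 * ((n : ℝ) ^ 2 * C) ^ 2 :=
    calc D ^ 6 = D ^ 4 * D ^ 2 := by ring
      _ ≤ (32768 * n) ^ 4 * C ^ 2 := by gcongr
      _ = _ := by ring
  have hX : 0 ≤ ((n : ℝ) ^ 2 * C) ^ 2 := sq_nonneg _
  rcases hρ.eq_or_lt with rfl | hρ
  · refine ⟨D, by linarith, ?_⟩
    simpa [perturb_zero] using hD
  rcases le_or_gt (D * ρ ^ 2 * n) 1 with h | h
  · refine ⟨12 * D, ?_, hPL.poincareLE_perturb hD0 hD hρ h2 h⟩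
    rw [mul_pow]
    linarith
  · have := isProbabilityMeasure_perturb μ
      (integrable_exp_neg_norm_sq μ (by positivity : 0 ≤ ρ / 2))
    refine ⟨6 / ρ, ?_, (hPL.perturb ρ).poincareLE hρ⟩
    have h3 : (1 / ρ) ^ 2 ≤ n * D := by
      rw [one_div_pow, div_le_iff₀ (by positivity)]
      linarith
    have h4 : (1 / ρ) ^ 6 ≤ 32768 * ((n : ℝ) ^ 2 * C) ^ 2 :=
      calc (1 / ρ) ^ 6 = ((1 / ρ) ^ 2) ^ 3 := by ring
        _ ≤ (n * D) ^ 3 := by gcongr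
        _ = (n : ℝ) ^ 3 * (D * D ^ 2) := by ring
        _ ≤ (n : ℝ) ^ 3 * (32768 * n * C ^ 2) := by gcongr
        _ = _ := by ring
    have h5 : (6 / ρ) ^ 6 = 46656 * (1 / ρ) ^ 6 := by ring
    linarith

/-- There is a universal constant `C` such that for every log-concave
isotropic probability measure `μ` on ℝⁿ and every `ρ ≥ 0`, the measure
`μ^ρ ∝ e^{-ρ|x|²/2} μ` satisfies `C_P(μ^ρ) ≤ C n^{2/3} C_P(μ)^{1/3}`. -/
theorem poincare_gaussian_perturbation_isotropic :
    ∃ C : ℝ, 0 < C ∧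
      ∀ (n : ℕ) (μ : Measure (En n)), IsProbabilityMeasure μ →
        IsLogConcave μ → (∫ x, x ∂μ) = 0 →
        (∀ i j : Fin n, (∫ x, x i * x j ∂μ) = if i = j then (1 : ℝ) else 0) →
        ∀ Cμ ρ : ℝ, 0 ≤ Cμ → PoincareLE μ Cμ → 0 ≤ ρ →
          PoincareLE (perturb μ fun x => ρ / 2 * ‖x‖ ^ 2)
            (C * (n : ℝ) ^ ((2 : ℝ) / 3) * Cμ ^ ((1 : ℝ) / 3)) := by
  refine ⟨393216, by norm_num, fun n μ hP hμ _ hcov Cμ ρ hCμ hμC hρ => ?_⟩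
  rcases Nat.eq_zero_or_pos n with rfl | hn
  · have := isProbabilityMeasure_perturb μ
      (integrable_exp_neg_norm_sq μ (by positivity : 0 ≤ ρ / 2))
    exact poincareLE_of_dim_zero (by positivity)
  have hcov' : ∀ i : Fin n, ∫ x, x i * x i ∂μ = 1 := fun i => by simpa using hcov i i
  have hPL := hμ.prekopaLeindler
  obtain ⟨c, hc, hcP⟩ := hPL.exists_poincareLE_perturb hn hCμ hμC hρ hcov'
  exact hcP.mono (le_mul_rpow_of_pow_six_le (by norm_num) n.cast_nonneg hCμ hc)
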